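/- arXiv:2310.20262 — 3 statements merged into one kernel-verified Lean document; each statement's English description precedes it below -/
import Mathlib

section
/- Let D be a nonempty bounded convex open subset of a finite-dimensional real normed vector space with Hilbert metric d_H. Then the geodesic metric space (D, d_H) is Busemann convex if and only if D is an ellipsoid. -/
/-- `d` is the Hilbert (cross-ratio) metric on the bounded convex open set `D`:
`d x x = 0` on `D`, and for distinct `x y ∈ D` there are boundary points `a b ∈ ∂D`
with `x` between `a` and `y`, `y` between `x` and `b`, and
`d x y = log ((‖y−a‖ ‖x−b‖)/(‖x−a‖ ‖y−b‖))`. -/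
def IsHilbertMetric {V : Type*} [NormedAddCommGroup V] [NormedSpace ℝ V]
    (D : Set V) (d : V → V → ℝ) : Prop :=
  (∀ x ∈ D, d x x = 0) ∧
  ∀ x ∈ D, ∀ y ∈ D, x ≠ y →
    ∃ a ∈ frontier D, ∃ b ∈ frontier D,
      x ∈ segment ℝ a y ∧ y ∈ segment ℝ x b ∧
      d x y = Real.log ((‖y - a‖ * ‖x - b‖) / (‖x - a‖ * ‖y - b‖))

/-- A constant-speed geodesic segment in `(D, d)`, parametrized on `[0,1]`. -/
def IsGeodesicSegment {V : Type*} (D : Set V) (d : V → V → ℝ) (γ : ℝ → V) : Prop :=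
  (∀ t ∈ Set.Icc (0 : ℝ) 1, γ t ∈ D) ∧
  ∀ s ∈ Set.Icc (0 : ℝ) 1, ∀ t ∈ Set.Icc (0 : ℝ) 1,
    d (γ s) (γ t) = |s - t| * d (γ 0) (γ 1)

/-- `(D, d)` is Busemann convex: for any two geodesic segments, the distance between
points at equal parameter is bounded by the convex combination of the distances between
the corresponding endpoints. -/
def BusemannConvexOn {V : Type*} (D : Set V) (d : V → V → ℝ) : Prop :=
  ∀ γ γ' : ℝ → V, IsGeodesicSegment D d γ → IsGeodesicSegment D d γ' →
    ∀ t ∈ Set.Icc (0 : ℝ) 1,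
      d (γ t) (γ' t) ≤ (1 - t) * d (γ 0) (γ' 0) + t * d (γ 1) (γ' 1)

/-- `D` is an ellipsoid: the image of the open Euclidean unit ball under an
invertible affine map. -/
def IsEllipsoid {V : Type*} [NormedAddCommGroup V] [NormedSpace ℝ V] (D : Set V) : Prop :=
  ∃ (L : EuclideanSpace ℝ (Fin (Module.finrank ℝ V)) ≃ₗ[ℝ] V) (c : V),
    D = (fun u => c + L u) ''
      Metric.ball (0 : EuclideanSpace ℝ (Fin (Module.finrank ℝ V))) 1

theorem IsHilbertMetric.exists_chord {V : Type*} [NormedAddCommGroup V] [NormedSpace ℝ V]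
    {D : Set V} {d : V → V → ℝ} (hd : IsHilbertMetric D d) (hDo : IsOpen D) {x y : V}
    (hx : x ∈ D) (hy : y ∈ D) (hxy : x ≠ y) :
    ∃ α β : ℝ, 0 < α ∧ 0 < β ∧ x - α • (y - x) ∈ frontier D ∧ y + β • (y - x) ∈ frontier D ∧
      d x y = Real.log ((1 + α) * (1 + β) / (α * β)) := by
  obtain ⟨a, ha, b, hb, ⟨s, t, hs, ht, hst, hxa⟩, ⟨s', t', hs', ht', hst', hyb⟩, h⟩ :=
    hd.2 x hx y hy hxy
  have hdisj : ∀ {p q : V}, p ∈ D → q ∈ frontier D → p ≠ q := by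
    rintro p q hp hq rfl
    exact (hDo.frontier_eq ▸ hq).2 hp
  have hs0 : s ≠ 0 := by
    rintro rfl
    obtain rfl : t = 1 := by linarith
    exact hxy (by simpa using hxa.symm)
  have ht0 : t ≠ 0 := by
    rintro rfl
    obtain rfl : s = 1 := by linarith
    exact hdisj hx ha (by simpa using hxa.symm)
  have hs0' : s' ≠ 0 := by
    rintro rfl
    obtain rfl : t' = 1 := by linarith
    exact hdisj hy hb (by simpa using hyb.symm)
  have ht0' : t' ≠ 0 := by
    rintro rfl
    obtain rfl : s' = 1 := by linarith
    exact hxy (by simpa using hyb)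
  have hα : 0 < t / s := by positivity
  have hβ : 0 < s' / t' := by positivity
  have ea : a = x - (t / s) • (y - x) := by
    have : s • a = s • (x - (t / s) • (y - x)) := by
      have hs1 : s = 1 - t := by linarith
      rw [smul_sub, smul_smul, mul_div_cancel₀ _ hs0, eq_sub_of_add_eq hxa, hs1]
      module
    exact smul_right_injective V hs0 this
  have eb : b = y + (s' / t') • (y - x) := by
    have : t' • b = t' • (y + (s' / t') • (y - x)) := by
      have hs1 : t' = 1 - s' := by linarith
      rw [smul_add, smul_smul, mul_div_cancel₀ _ ht0', eq_sub_of_add_eq' hyb, hs1]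
      module
    exact smul_right_injective V ht0' this
  refine ⟨t / s, s' / t', hα, hβ, ea ▸ ha, eb ▸ hb, ?_⟩
  have hn : ‖y - x‖ ≠ 0 := norm_ne_zero_iff.2 (sub_ne_zero.2 hxy.symm)
  have e1 : y - a = (1 + t / s) • (y - x) := by rw [ea]; module
  have e2 : x - a = (t / s) • (y - x) := by rw [ea]; module
  have e3 : x - b = -((1 + s' / t') • (y - x)) := by rw [eb]; module
  have e4 : y - b = -((s' / t') • (y - x)) := by rw [eb]; module
  rw [h, e1, e2, e3, e4, norm_neg, norm_neg]
  simp only [norm_smul, Real.norm_eq_abs]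
  rw [abs_of_pos hα, abs_of_pos hβ, abs_of_pos (by positivity : 0 < 1 + t / s),
    abs_of_pos (by positivity : 0 < 1 + s' / t')]
  congr 1
  rw [div_eq_div_iff (by positivity) (by positivity)]
  ring

section Hyperboloid

theorem Real.sinh_mul_cosh_sub_le {t : ℝ} (ht0 : 0 ≤ t) (ht1 : t ≤ 1) {c p : ℝ} (hc : 0 ≤ c)
    (hp : 0 ≤ p) :
    Real.sinh c * (Real.cosh (t * p) - Real.cosh (t * c)) ≤
      t * Real.sinh (t * c) * (Real.cosh p - Real.cosh c) := by
  have hlin : ∀ x : ℝ, HasDerivAt (fun x => t * x) t x := fun x => by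
    simpa using (hasDerivAt_id x).const_mul t
  have hN : ∀ x, 0 ≤ x →
      t * Real.cosh (t * x) * Real.sinh x - Real.sinh (t * x) * Real.cosh x ≤ 0 := by
    intro x hx
    have hder : ∀ x, HasDerivAt
        (fun x => t * Real.cosh (t * x) * Real.sinh x - Real.sinh (t * x) * Real.cosh x)
        ((t ^ 2 - 1) * (Real.sinh (t * x) * Real.sinh x)) x := fun x => by
      have := ((((hlin x).cosh).const_mul t).mul (Real.hasDerivAt_sinh x)).sub
        (((hlin x).sinh).mul (Real.hasDerivAt_cosh x))
      exact this.congr_deriv (by ring)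
    have hanti : AntitoneOn
        (fun x => t * Real.cosh (t * x) * Real.sinh x - Real.sinh (t * x) * Real.cosh x)
        (Set.Ici 0) := by
      refine antitoneOn_of_deriv_nonpos (convex_Ici 0)
        (fun x _ => (hder x).continuousAt.continuousWithinAt)
        (fun x _ => (hder x).differentiableAt.differentiableWithinAt) fun x hx => ?_
      rw [interior_Ici] at hx
      rw [(hder x).deriv]
      have h1 : 0 ≤ Real.sinh x := Real.sinh_nonneg_iff.2 hx.le
      have h2 : 0 ≤ Real.sinh (t * x) := Real.sinh_nonneg_iff.2 (mul_nonneg ht0 hx.le)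
      exact mul_nonpos_of_nonpos_of_nonneg (by nlinarith) (mul_nonneg h2 h1)
    simpa using hanti (Set.mem_Ici.2 le_rfl) (Set.mem_Ici.2 hx) hx
  have hratio : AntitoneOn (fun x => Real.sinh (t * x) / Real.sinh x) (Set.Ioi 0) := by
    have hder : ∀ x ∈ Set.Ioi (0 : ℝ), HasDerivAt (fun x => Real.sinh (t * x) / Real.sinh x)
        ((t * Real.cosh (t * x) * Real.sinh x - Real.sinh (t * x) * Real.cosh x) /
          Real.sinh x ^ 2) x := fun x hx => by
      have := ((hlin x).sinh).div (Real.hasDerivAt_sinh x) (Real.sinh_pos_iff.2 hx).ne'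
      exact this.congr_deriv (by ring)
    refine antitoneOn_of_deriv_nonpos (convex_Ioi 0)
      (fun x hx => (hder x hx).continuousAt.continuousWithinAt)
      (fun x hx => (hder x (by simpa using hx)).differentiableAt.differentiableWithinAt)
      fun x hx => ?_
    rw [interior_Ioi] at hx
    rw [(hder x hx).deriv]
    exact div_nonpos_of_nonpos_of_nonneg (hN x hx.le) (sq_nonneg _)
  have hmono : ∀ x y, 0 ≤ x → x ≤ y →
      0 ≤ Real.sinh (t * x) * Real.sinh y - Real.sinh x * Real.sinh (t * y) := by
    intro x y hx hxy
    rcases hx.eq_or_lt with rfl | hx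
    · simp
    · have h := hratio (Set.mem_Ioi.2 hx) (Set.mem_Ioi.2 (hx.trans_le hxy)) hxy
      have := (div_le_div_iff₀ (Real.sinh_pos_iff.2 (hx.trans_le hxy))
        (Real.sinh_pos_iff.2 hx)).1 h
      linarith
  have hder : ∀ x, HasDerivAt
      (fun x => t * Real.sinh (t * c) * Real.cosh x - Real.sinh c * Real.cosh (t * x))
      (t * (Real.sinh (t * c) * Real.sinh x - Real.sinh c * Real.sinh (t * x))) x := fun x => by
    have := ((Real.hasDerivAt_cosh x).const_mul (t * Real.sinh (t * c))).sub
      (((hlin x).cosh).const_mul (Real.sinh c))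
    exact this.congr_deriv (by ring)
  rcases le_total p c with h | h
  · have hanti : AntitoneOn
        (fun x => t * Real.sinh (t * c) * Real.cosh x - Real.sinh c * Real.cosh (t * x))
        (Set.Icc 0 c) := by
      refine antitoneOn_of_deriv_nonpos (convex_Icc 0 c)
        (fun x _ => (hder x).continuousAt.continuousWithinAt)
        (fun x _ => (hder x).differentiableAt.differentiableWithinAt) fun x hx => ?_
      rw [interior_Icc] at hx
      rw [(hder x).deriv]
      have := hmono x c hx.1.le hx.2.le
      exact mul_nonpos_of_nonneg_of_nonpos ht0 (by linarith)
    have := hanti (Set.mem_Icc.2 ⟨hp, h⟩) (Set.mem_Icc.2 ⟨hc, le_rfl⟩) h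
    simp only at this
    linarith
  · have hmon : MonotoneOn
        (fun x => t * Real.sinh (t * c) * Real.cosh x - Real.sinh c * Real.cosh (t * x))
        (Set.Ici c) := by
      refine monotoneOn_of_deriv_nonneg (convex_Ici c)
        (fun x _ => (hder x).continuousAt.continuousWithinAt)
        (fun x _ => (hder x).differentiableAt.differentiableWithinAt) fun x hx => ?_
      rw [interior_Ici] at hx
      rw [(hder x).deriv]
      exact mul_nonneg ht0 (hmono c x hc hx.le)
    have := hmon (Set.mem_Ici.2 le_rfl) (Set.mem_Ici.2 h) h
    simp only at this
    linarith

/-- In hyperbolic trigonometric form: a triangle with sides `a`, `b`, `c` and cosine `k` of the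
angle opposite to `c` satisfies the Busemann inequality for the ratio `t`. -/
theorem Real.cosh_mul_cosh_sub_le_of_le {a b c k t : ℝ} (ha : 0 ≤ a) (hb : 0 ≤ b)
    (hc : 0 ≤ c) (hk : |k| ≤ 1) (ht0 : 0 ≤ t) (ht1 : t ≤ 1)
    (h : Real.cosh c = Real.cosh a * Real.cosh b - k * (Real.sinh a * Real.sinh b)) :
    Real.cosh (t * a) * Real.cosh (t * b) - k * (Real.sinh (t * a) * Real.sinh (t * b)) ≤
      Real.cosh (t * c) := by
  obtain ⟨hk1, hk2⟩ := abs_le.1 hk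
  have e1 : Real.cosh c =
      (1 + k) / 2 * Real.cosh |a - b| + (1 - k) / 2 * Real.cosh (a + b) := by
    rw [Real.cosh_abs, Real.cosh_sub, Real.cosh_add, h]; ring
  have e2 : Real.cosh (t * a) * Real.cosh (t * b) - k * (Real.sinh (t * a) * Real.sinh (t * b)) =
      (1 + k) / 2 * Real.cosh (t * |a - b|) + (1 - k) / 2 * Real.cosh (t * (a + b)) := by
    have : t * |a - b| = |t * a - t * b| := by
      rw [← mul_sub, abs_mul, abs_of_nonneg ht0]
    rw [this, Real.cosh_abs, mul_add, Real.cosh_sub, Real.cosh_add]; ring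
  rw [e2]
  have hp : 0 ≤ |a - b| := abs_nonneg _
  have hq : 0 ≤ a + b := add_nonneg ha hb
  rcases hc.eq_or_lt with rfl | hc
  · rw [Real.cosh_zero] at e1
    rw [mul_zero, Real.cosh_zero]
    have hm : ∀ x, 0 ≤ x → Real.cosh (t * x) ≤ Real.cosh x := fun x hx => by
      rw [Real.cosh_le_cosh, abs_of_nonneg (mul_nonneg ht0 hx), abs_of_nonneg hx]
      exact mul_le_of_le_one_left hx ht1
    have h1 := mul_le_mul_of_nonneg_left (hm _ hp) (by linarith : 0 ≤ (1 + k) / 2)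
    have h2 := mul_le_mul_of_nonneg_left (hm _ hq) (by linarith : 0 ≤ (1 - k) / 2)
    linarith
  · have hs : 0 < Real.sinh c := Real.sinh_pos_iff.2 hc
    have h1 := mul_le_mul_of_nonneg_left (Real.sinh_mul_cosh_sub_le ht0 ht1 hc.le hp)
      (by linarith : 0 ≤ (1 + k) / 2)
    have h2 := mul_le_mul_of_nonneg_left (Real.sinh_mul_cosh_sub_le ht0 ht1 hc.le hq)
      (by linarith : 0 ≤ (1 - k) / 2)
    refine le_of_mul_le_mul_left ?_ hs
    have h3 : t * Real.sinh (t * c) * Real.cosh c = t * Real.sinh (t * c) *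
      ((1 + k) / 2 * Real.cosh |a - b| + (1 - k) / 2 * Real.cosh (a + b)) := by rw [← e1]
    nlinarith

variable {E : Type*} [NormedAddCommGroup E] [InnerProductSpace ℝ E]

/-- The Lorentzian form on `E × ℝ`. -/
def lorentzForm (X Y : E × ℝ) : ℝ := X.2 * Y.2 - inner ℝ X.1 Y.1

/-- The upper sheet of the hyperboloid in `E × ℝ`. -/
def OnHyperboloid (X : E × ℝ) : Prop := lorentzForm X X = 1 ∧ 0 < X.2

theorem lorentzForm_comm (X Y : E × ℝ) : lorentzForm X Y = lorentzForm Y X := by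
  simp [lorentzForm, mul_comm, real_inner_comm]

theorem lorentzForm_add_right (X Y Z : E × ℝ) :
    lorentzForm X (Y + Z) = lorentzForm X Y + lorentzForm X Z := by
  simp [lorentzForm, inner_add_right]; ring

theorem lorentzForm_smul_right (X Y : E × ℝ) (c : ℝ) :
    lorentzForm X (c • Y) = c * lorentzForm X Y := by
  simp [lorentzForm, inner_smul_right]; ring

theorem lorentzForm_add_left (X Y Z : E × ℝ) :
    lorentzForm (X + Y) Z = lorentzForm X Z + lorentzForm Y Z := by
  simp [lorentzForm, inner_add_left]; ring

theorem lorentzForm_smul_left (X Y : E × ℝ) (c : ℝ) :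
    lorentzForm (c • X) Y = c * lorentzForm X Y := by
  simp [lorentzForm, inner_smul_left]; ring

theorem lorentzForm_self_le_sq {P : E × ℝ} (hP : lorentzForm P P = 1) (X : E × ℝ) :
    lorentzForm X X ≤ lorentzForm P X ^ 2 := by
  obtain ⟨u, k⟩ := P
  obtain ⟨z, r⟩ := X
  simp only [lorentzForm] at *
  have h1 : 0 ≤ inner ℝ (r • u - k • z) (r • u - k • z) := real_inner_self_nonneg
  have h2 : 0 ≤ inner ℝ u (r • u - k • z) ^ 2 := sq_nonneg _
  simp only [inner_sub_left, inner_sub_right, inner_smul_left, inner_smul_right,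
    real_inner_comm z u, conj_trivial] at *
  have hu : 0 ≤ inner ℝ u u := real_inner_self_nonneg
  have hk : 0 < k * k := by linarith
  generalize inner ℝ u u = uu at *
  generalize inner ℝ z z = zz at *
  generalize inner ℝ u z = s at *
  obtain rfl : uu = k * k - 1 := by linarith
  refine sub_nonneg.1 (nonneg_of_mul_nonneg_right ?_ hk)
  nlinarith

theorem sq_lorentzForm_sub_le {P : E × ℝ} (hP : lorentzForm P P = 1) {X Y : E × ℝ}
    (hX : lorentzForm X X = 1) (hY : lorentzForm Y Y = 1) :
    (lorentzForm P X * lorentzForm P Y - lorentzForm X Y) ^ 2 ≤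
      (lorentzForm P X ^ 2 - 1) * (lorentzForm P Y ^ 2 - 1) := by
  have h : ∀ s : ℝ, 0 ≤ (lorentzForm P Y ^ 2 - 1) * (s * s) +
      (2 * (lorentzForm P X * lorentzForm P Y - lorentzForm X Y)) * s +
      (lorentzForm P X ^ 2 - 1) := fun s => by
    have := lorentzForm_self_le_sq hP (X + s • Y)
    simp only [lorentzForm_add_left, lorentzForm_add_right, lorentzForm_smul_left,
      lorentzForm_smul_right, hX, hY, lorentzForm_comm Y X] at this
    linarith
  have := discrim_le_zero h
  simp only [discrim] at this
  linarith

theorem OnHyperboloid.inner_lt {X Y : E × ℝ} (hX : OnHyperboloid X) (hY : OnHyperboloid Y) :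
    0 < lorentzForm X Y := by
  obtain ⟨hX1, hX2⟩ := hX
  obtain ⟨hY1, hY2⟩ := hY
  simp only [lorentzForm, real_inner_self_eq_norm_sq] at *
  have h1 : ‖X.1‖ < X.2 := lt_of_pow_lt_pow_left₀ 2 hX2.le (by nlinarith)
  have h2 : ‖Y.1‖ < Y.2 := lt_of_pow_lt_pow_left₀ 2 hY2.le (by nlinarith)
  have h3 := real_inner_le_norm X.1 Y.1
  have := mul_lt_mul'' h1 h2 (norm_nonneg _) (norm_nonneg _)
  linarith

theorem OnHyperboloid.one_le {X Y : E × ℝ} (hX : OnHyperboloid X) (hY : OnHyperboloid Y) :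
    1 ≤ lorentzForm X Y := by
  have h := lorentzForm_self_le_sq hX.1 Y
  rw [hY.1] at h
  nlinarith [hX.inner_lt hY]

theorem OnHyperboloid.eq_of_lorentzForm_eq_one {X Y : E × ℝ} (hX : OnHyperboloid X)
    (hY : OnHyperboloid Y) (h : lorentzForm X Y = 1) : X = Y := by
  have h1 : lorentzForm X (X + (-1 : ℝ) • Y) = 0 := by
    rw [lorentzForm_add_right, lorentzForm_smul_right, hX.1, h]; norm_num
  have h2 : lorentzForm (X + (-1 : ℝ) • Y) (X + (-1 : ℝ) • Y) = 0 := by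
    rw [lorentzForm_add_left, h1, lorentzForm_smul_left, lorentzForm_add_right,
      lorentzForm_smul_right, hY.1, lorentzForm_comm Y X, h]; norm_num
  have hXX := hX.1
  suffices hZ : X + (-1 : ℝ) • Y = 0 by
    rwa [neg_one_smul, ← sub_eq_add_neg, sub_eq_zero] at hZ
  generalize X + (-1 : ℝ) • Y = Z at *
  simp only [lorentzForm, real_inner_self_eq_norm_sq] at *
  have h3 := abs_real_inner_le_norm X.1 Z.1
  have h4 : (X.2 * Z.2) ^ 2 ≤ (‖X.1‖ * ‖Z.1‖) ^ 2 := by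
    rw [sq_le_sq, abs_of_nonneg (by positivity : 0 ≤ ‖X.1‖ * ‖Z.1‖)]
    rwa [sub_eq_zero.1 h1]
  have h5 : Z.2 = 0 := by
    have : Z.2 ^ 2 ≤ 0 := by
      have e1 : ‖Z.1‖ ^ 2 = Z.2 ^ 2 := by linarith
      have e2 : ‖X.1‖ ^ 2 = X.2 ^ 2 - 1 := by linarith
      rw [mul_pow, mul_pow, e1, e2] at h4
      linarith
    nlinarith
  have h6 : Z.1 = 0 := by
    rw [h5] at h2
    have : ‖Z.1‖ ^ 2 = 0 := by linarith
    simpa using this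
  exact Prod.ext h6 h5

/-- The hyperbolic distance between points of the hyperboloid. -/
noncomputable def hyperboloidDist (X Y : E × ℝ) : ℝ := Real.arcosh (lorentzForm X Y)

theorem hyperboloidDist_comm (X Y : E × ℝ) : hyperboloidDist X Y = hyperboloidDist Y X := by
  rw [hyperboloidDist, lorentzForm_comm, hyperboloidDist]

theorem OnHyperboloid.cosh_dist {X Y : E × ℝ} (hX : OnHyperboloid X) (hY : OnHyperboloid Y) :
    Real.cosh (hyperboloidDist X Y) = lorentzForm X Y := Real.cosh_arcosh (hX.one_le hY)

theorem OnHyperboloid.dist_nonneg {X Y : E × ℝ} (hX : OnHyperboloid X) (hY : OnHyperboloid Y) :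
    0 ≤ hyperboloidDist X Y := Real.arcosh_nonneg (hX.one_le hY)

theorem OnHyperboloid.eq_of_dist_eq_zero {X Y : E × ℝ} (hX : OnHyperboloid X)
    (hY : OnHyperboloid Y) (h : hyperboloidDist X Y = 0) : X = Y :=
  hX.eq_of_lorentzForm_eq_one hY ((Real.arcosh_eq_zero_iff (hX.one_le hY)).1 h)

theorem OnHyperboloid.dist_self {X : E × ℝ} (hX : OnHyperboloid X) : hyperboloidDist X X = 0 := by
  rw [hyperboloidDist, hX.1, Real.arcosh_zero]

theorem OnHyperboloid.exists_cos {P X Y : E × ℝ} (hP : OnHyperboloid P) (hX : OnHyperboloid X)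
    (hY : OnHyperboloid Y) :
    ∃ k : ℝ, |k| ≤ 1 ∧ lorentzForm X Y = Real.cosh (hyperboloidDist P X) *
      Real.cosh (hyperboloidDist P Y) -
        k * (Real.sinh (hyperboloidDist P X) * Real.sinh (hyperboloidDist P Y)) := by
  have h := sq_lorentzForm_sub_le hP.1 hX.1 hY.1
  rw [← hP.cosh_dist hX, ← hP.cosh_dist hY, ← Real.sinh_sq, ← Real.sinh_sq, ← mul_pow] at h
  have h' := sq_le_sq.1 h
  set S := Real.sinh (hyperboloidDist P X) * Real.sinh (hyperboloidDist P Y)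
  set N := Real.cosh (hyperboloidDist P X) * Real.cosh (hyperboloidDist P Y) - lorentzForm X Y
  rcases eq_or_ne S 0 with hS | hS
  · refine ⟨0, by simp, ?_⟩
    have : N = 0 := by simpa [hS] using h'
    simp only [N] at this
    linarith
  · refine ⟨N / S, ?_, ?_⟩
    · rw [abs_div]
      exact div_le_one_of_le₀ h' (abs_nonneg _)
    · rw [div_mul_cancel₀ _ hS]
      simp only [N]
      ring

theorem OnHyperboloid.dist_triangle {X P Y : E × ℝ} (hX : OnHyperboloid X) (hP : OnHyperboloid P)
    (hY : OnHyperboloid Y) :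
    hyperboloidDist X Y ≤ hyperboloidDist X P + hyperboloidDist P Y := by
  obtain ⟨k, hk, h⟩ := hP.exists_cos hX hY
  rw [hyperboloidDist_comm X P]
  have ha := hP.dist_nonneg hX
  have hb := hP.dist_nonneg hY
  rw [← abs_of_nonneg (hX.dist_nonneg hY), ← abs_of_nonneg (add_nonneg ha hb),
    ← Real.cosh_le_cosh, hX.cosh_dist hY, h, Real.cosh_add]
  have : 0 ≤ Real.sinh (hyperboloidDist P X) * Real.sinh (hyperboloidDist P Y) :=
    mul_nonneg (Real.sinh_nonneg_iff.2 ha) (Real.sinh_nonneg_iff.2 hb)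
  nlinarith [(abs_le.1 hk).1]

/-- `Z` divides the hyperbolic segment from `P` to `X` in the ratio `t : 1 - t`. -/
def IsHyperbolicPoint (P X Z : E × ℝ) (t : ℝ) : Prop :=
  OnHyperboloid Z ∧ hyperboloidDist P Z = t * hyperboloidDist P X ∧
    hyperboloidDist Z X = (1 - t) * hyperboloidDist P X

theorem IsHyperbolicPoint.symm {P X Z : E × ℝ} {t : ℝ} (h : IsHyperbolicPoint P X Z t) :
    IsHyperbolicPoint X P Z (1 - t) := by
  refine ⟨h.1, ?_, ?_⟩
  · rw [hyperboloidDist_comm, h.2.2, hyperboloidDist_comm X]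
  · rw [hyperboloidDist_comm, h.2.1, hyperboloidDist_comm X, sub_sub_cancel]

theorem sinh_sq_identity (r s : ℝ) :
    Real.sinh s * Real.sinh s + Real.sinh r * Real.sinh r +
      2 * (Real.sinh s * Real.sinh r * Real.cosh (s + r)) = Real.sinh (s + r) * Real.sinh (s + r) := by
  rw [Real.cosh_add, Real.sinh_add]
  have h1 := Real.cosh_sq s
  have h2 := Real.cosh_sq r
  linear_combination (- Real.sinh r ^ 2) * h1 - Real.sinh s ^ 2 * h2

theorem onHyperboloid_interpolate {P X : E × ℝ} (hP : OnHyperboloid P) (hX : OnHyperboloid X)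
    {t : ℝ} (ht0 : 0 ≤ t) (ht1 : t ≤ 1) (ha : 0 < hyperboloidDist P X) :
    OnHyperboloid ((Real.sinh ((1 - t) * hyperboloidDist P X) / Real.sinh (hyperboloidDist P X)) • P +
      (Real.sinh (t * hyperboloidDist P X) / Real.sinh (hyperboloidDist P X)) • X) := by
  have hc := hP.cosh_dist hX
  set a := hyperboloidDist P X
  have hs : 0 < Real.sinh a := Real.sinh_pos_iff.2 ha
  have h1 : 0 ≤ Real.sinh ((1 - t) * a) :=
    Real.sinh_nonneg_iff.2 (mul_nonneg (by linarith) ha.le)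
  have h2 : 0 ≤ Real.sinh (t * a) := Real.sinh_nonneg_iff.2 (mul_nonneg ht0 ha.le)
  refine ⟨?_, ?_⟩
  · simp only [lorentzForm_add_left, lorentzForm_add_right, lorentzForm_smul_left,
      lorentzForm_smul_right, hP.1, hX.1, lorentzForm_comm X P, ← hc]
    have := sinh_sq_identity (t * a) ((1 - t) * a)
    rw [show (1 - t) * a + t * a = a by ring] at this
    field_simp
    linarith
  · simp only [Prod.snd_add, Prod.smul_snd, smul_eq_mul]
    have hP2 := hP.2
    have hX2 := hX.2
    rcases ht0.eq_or_lt with rfl | ht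
    · simp only [sub_zero, one_mul, zero_mul, Real.sinh_zero, zero_div, add_zero]
      positivity
    · have : 0 < Real.sinh (t * a) := Real.sinh_pos_iff.2 (mul_pos ht ha)
      positivity

theorem exists_isHyperbolicPoint {P X : E × ℝ} (hP : OnHyperboloid P) (hX : OnHyperboloid X)
    {t : ℝ} (ht0 : 0 ≤ t) (ht1 : t ≤ 1) : ∃ Z, IsHyperbolicPoint P X Z t := by
  have hc := hP.cosh_dist hX
  rcases (hP.dist_nonneg hX).eq_or_lt with h0 | ha
  · refine ⟨P, hP, ?_, ?_⟩
    · rw [← h0, hP.dist_self, mul_zero]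
    · rw [← h0, mul_zero]
  · have hI := onHyperboloid_interpolate hP hX ht0 ht1 ha
    refine ⟨_, hI, ?_, ?_⟩
    · rw [hyperboloidDist, lorentzForm_add_right, lorentzForm_smul_right, lorentzForm_smul_right,
        hP.1, ← hc]
      set a := hyperboloidDist P X
      have hs : 0 < Real.sinh a := Real.sinh_pos_iff.2 ha
      refine Eq.trans (congrArg Real.arcosh ?_) (Real.arcosh_cosh (mul_nonneg ht0 ha.le))
      field_simp
      rw [sub_mul, one_mul, Real.sinh_sub]
      ring
    · rw [hyperboloidDist, lorentzForm_add_left, lorentzForm_smul_left, lorentzForm_smul_left,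
        hX.1, ← hc]
      set a := hyperboloidDist P X
      have hs : 0 < Real.sinh a := Real.sinh_pos_iff.2 ha
      refine Eq.trans (congrArg Real.arcosh ?_)
        (Real.arcosh_cosh (mul_nonneg (by linarith : 0 ≤ 1 - t) ha.le))
      field_simp
      rw [sub_mul, one_mul, Real.sinh_sub, Real.cosh_sub]
      have := Real.cosh_sq a
      linear_combination (-Real.sinh (t * a)) * this

theorem IsHyperbolicPoint.eq_interpolate {P X Z : E × ℝ} {t : ℝ} (hP : OnHyperboloid P)
    (hX : OnHyperboloid X) (ht0 : 0 ≤ t) (ht1 : t ≤ 1) (ha : 0 < hyperboloidDist P X)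
    (h : IsHyperbolicPoint P X Z t) :
    Z = (Real.sinh ((1 - t) * hyperboloidDist P X) / Real.sinh (hyperboloidDist P X)) • P +
      (Real.sinh (t * hyperboloidDist P X) / Real.sinh (hyperboloidDist P X)) • X := by
  refine h.1.eq_of_lorentzForm_eq_one (onHyperboloid_interpolate hP hX ht0 ht1 ha) ?_
  rw [lorentzForm_add_right, lorentzForm_smul_right, lorentzForm_smul_right, lorentzForm_comm Z P,
    ← hP.cosh_dist h.1, ← h.1.cosh_dist hX, h.2.1, h.2.2]
  set a := hyperboloidDist P X
  have hs : 0 < Real.sinh a := Real.sinh_pos_iff.2 ha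
  field_simp
  have := Real.sinh_add ((1 - t) * a) (t * a)
  rw [show (1 - t) * a + t * a = a by ring] at this
  linarith

theorem IsHyperbolicPoint.dist_le {P X Y Z W : E × ℝ} {t : ℝ} (hP : OnHyperboloid P)
    (hX : OnHyperboloid X) (hY : OnHyperboloid Y) (ht0 : 0 ≤ t) (ht1 : t ≤ 1)
    (hZ : IsHyperbolicPoint P X Z t) (hW : IsHyperbolicPoint P Y W t) :
    hyperboloidDist Z W ≤ t * hyperboloidDist X Y := by
  rcases (hP.dist_nonneg hX).eq_or_lt with h0 | ha
  · obtain rfl := hP.eq_of_dist_eq_zero hX h0.symm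
    obtain rfl := hP.eq_of_dist_eq_zero hZ.1 (by rw [hZ.2.1, ← h0, mul_zero])
    exact hW.2.1.le
  rcases (hP.dist_nonneg hY).eq_or_lt with h0 | hb
  · obtain rfl := hP.eq_of_dist_eq_zero hY h0.symm
    obtain rfl := hP.eq_of_dist_eq_zero hW.1 (by rw [hW.2.1, ← h0, mul_zero])
    rw [hyperboloidDist_comm, hyperboloidDist_comm X]
    exact hZ.2.1.le
  obtain ⟨k, hk, h⟩ := hP.exists_cos hX hY
  have hc := hX.dist_nonneg hY
  have hcc := hX.cosh_dist hY
  have key := Real.cosh_mul_cosh_sub_le_of_le ha.le hb.le hc hk ht0 ht1 (hcc.trans h)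
  rw [← abs_of_nonneg (hZ.1.dist_nonneg hW.1), ← abs_of_nonneg (mul_nonneg ht0 hc),
    ← Real.cosh_le_cosh, hZ.1.cosh_dist hW.1]
  refine le_trans (le_of_eq ?_) key
  rw [hZ.eq_interpolate hP hX ht0 ht1 ha, hW.eq_interpolate hP hY ht0 ht1 hb]
  simp only [lorentzForm_add_left, lorentzForm_add_right, lorentzForm_smul_left,
      lorentzForm_smul_right, hP.1, lorentzForm_comm X P, h, ← hP.cosh_dist hX,
      ← hP.cosh_dist hY]
  set a := hyperboloidDist P X
  set b := hyperboloidDist P Y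
  have hsa : 0 < Real.sinh a := Real.sinh_pos_iff.2 ha
  have hsb : 0 < Real.sinh b := Real.sinh_pos_iff.2 hb
  field_simp
  simp only [sub_mul, one_mul, Real.sinh_sub]
  ring

theorem IsHyperbolicPoint.dist_le_convexCombination {X Y X' Y' Z Z' : E × ℝ} {t : ℝ}
    (hX : OnHyperboloid X) (hY : OnHyperboloid Y) (hX' : OnHyperboloid X')
    (hY' : OnHyperboloid Y') (ht0 : 0 ≤ t) (ht1 : t ≤ 1) (hZ : IsHyperbolicPoint X Y Z t)
    (hZ' : IsHyperbolicPoint X' Y' Z' t) :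
    hyperboloidDist Z Z' ≤ (1 - t) * hyperboloidDist X X' + t * hyperboloidDist Y Y' := by
  obtain ⟨W, hW⟩ := exists_isHyperbolicPoint hX hY' ht0 ht1
  have h1 := hZ.dist_le hX hY hY' ht0 ht1 hW
  have h2 := hW.symm.dist_le hY' hX hX' (by linarith) (by linarith) hZ'.symm
  have h3 := hZ.1.dist_triangle hW.1 hZ'.1
  linarith

/-- The central projection of the unit ball onto the hyperboloid. -/
noncomputable def hyperboloidLift (u : E) : E × ℝ :=
  ((√(1 - ‖u‖ ^ 2))⁻¹ • u, (√(1 - ‖u‖ ^ 2))⁻¹)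

theorem lorentzForm_hyperboloidLift (u v : E) :
    lorentzForm (hyperboloidLift u) (hyperboloidLift v) =
      (1 - inner ℝ u v) / (√(1 - ‖u‖ ^ 2) * √(1 - ‖v‖ ^ 2)) := by
  simp only [lorentzForm, hyperboloidLift, inner_smul_left, inner_smul_right, conj_trivial]
  rw [div_eq_mul_inv, mul_inv]
  ring

theorem onHyperboloid_hyperboloidLift {u : E} (hu : ‖u‖ < 1) :
    OnHyperboloid (hyperboloidLift u) := by
  have h : 0 < 1 - ‖u‖ ^ 2 := by nlinarith [norm_nonneg u]
  refine ⟨?_, ?_⟩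
  · rw [lorentzForm_hyperboloidLift, real_inner_self_eq_norm_sq, Real.mul_self_sqrt h.le,
      div_self h.ne']
  · simp only [hyperboloidLift]
    positivity

theorem log_crossRatio_eq_two_mul_hyperboloidDist {u v : E} {α β : ℝ} (hα : 0 < α) (hβ : 0 < β)
    (huv : u ≠ v) (ha : ‖u - α • (v - u)‖ = 1) (hb : ‖v + β • (v - u)‖ = 1) :
    Real.log ((1 + α) * (1 + β) / (α * β)) =
      2 * hyperboloidDist (hyperboloidLift u) (hyperboloidLift v) := by
  have hW : 0 < ‖u‖ ^ 2 - 2 * inner ℝ u v + ‖v‖ ^ 2 := by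
    rw [← norm_sub_sq_real]
    have := norm_pos_iff.2 (sub_ne_zero.2 huv)
    positivity
  have e1 : ‖u - α • (v - u)‖ ^ 2 =
      ‖u‖ ^ 2 * (1 + α) ^ 2 - 2 * α * (1 + α) * inner ℝ u v + α ^ 2 * ‖v‖ ^ 2 := by
    simp only [← real_inner_self_eq_norm_sq, inner_sub_left, inner_sub_right, inner_smul_left,
      inner_smul_right, real_inner_comm u v, conj_trivial]
    ring
  have e2 : ‖v + β • (v - u)‖ ^ 2 =
      ‖v‖ ^ 2 * (1 + β) ^ 2 - 2 * β * (1 + β) * inner ℝ u v + β ^ 2 * ‖u‖ ^ 2 := by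
    simp only [← real_inner_self_eq_norm_sq, inner_sub_left, inner_sub_right, inner_smul_left,
      inner_smul_right, inner_add_left, inner_add_right, real_inner_comm u v, conj_trivial]
    ring
  rw [ha] at e1
  rw [hb] at e2
  rw [hyperboloidDist, lorentzForm_hyperboloidLift]
  generalize inner ℝ u v = s at *
  generalize ‖u‖ ^ 2 = A at *
  generalize ‖v‖ ^ 2 = B at *
  set W := A - 2 * s + B with hWdef
  have hαβ : 1 + α + β ≠ 0 := by positivity
  have hA : 1 - A = W * (α * (1 + β)) := by
    refine mul_left_cancel₀ hαβ ?_
    rw [hWdef]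
    linear_combination (1 + β) * e1 + α * e2
  have hB : 1 - B = W * ((1 + α) * β) := by
    refine mul_left_cancel₀ hαβ ?_
    rw [hWdef]
    linear_combination β * e1 + (1 + α) * e2
  have hs : 1 - s = W * ((1 + α) * (1 + β) + α * β) / 2 := by
    linear_combination (1 / 2) * hA + (1 / 2) * hB
  set R := (1 + α) * (1 + β) / (α * β) with hR
  have hRpos : 0 < R := by positivity
  have hR1 : 1 ≤ R := by
    rw [hR, one_le_div (by positivity)]
    nlinarith
  have hρ : 0 < √R := Real.sqrt_pos.2 hRpos
  have hρ2 : √R * √R = R := Real.mul_self_sqrt hRpos.le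
  have hAB : √(1 - A) * √(1 - B) = W * (α * β) * √R := by
    rw [← Real.sqrt_mul (by rw [hA]; positivity), hA, hB, Real.sqrt_eq_iff_mul_self_eq
      (by positivity) (by positivity)]
    rw [show W * (α * β) * √R * (W * (α * β) * √R) = (W * (α * β)) ^ 2 * (√R * √R) by ring, hρ2, hR]
    field_simp
  have hlog : Real.log R = 2 * Real.log √R := by
    rw [Real.log_sqrt hRpos.le]; ring
  rw [hlog]
  congr 1
  rw [← Real.arcosh_cosh (Real.log_nonneg (Real.one_le_sqrt.2 hR1)), Real.cosh_log hρ]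
  congr 1
  rw [hAB, hs]
  have hR' : (1 + α) * (1 + β) = √R * √R * (α * β) := by
    rw [hρ2, hR]; field_simp
  rw [hR']
  field_simp

end Hyperboloid

theorem frontier_image_ball_subset {V : Type*} [NormedAddCommGroup V] [NormedSpace ℝ V] {n : ℕ}
    (L : EuclideanSpace ℝ (Fin n) ≃ₗ[ℝ] V) (c : V) {D : Set V} (hDo : IsOpen D)
    (hD : D = (fun u => c + L u) '' Metric.ball (0 : EuclideanSpace ℝ (Fin n)) 1) :
    (∀ z, z ∈ D ↔ ‖L.symm (z - c)‖ < 1) ∧ ∀ z ∈ frontier D, ‖L.symm (z - c)‖ = 1 := by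
  have : FiniteDimensional ℝ V := L.finiteDimensional
  have hmem : ∀ z, z ∈ D ↔ ‖L.symm (z - c)‖ < 1 := by
    intro z
    rw [hD]
    constructor
    · rintro ⟨u, hu, rfl⟩
      simpa using hu
    · intro h
      exact ⟨L.symm (z - c), by simpa using h, by simp⟩
  refine ⟨hmem, fun z hz => ?_⟩
  have hcont : Continuous fun z => ‖L.symm (z - c)‖ :=
    ((L.symm.toLinearMap.continuous_of_finiteDimensional).comp
      (continuous_id.sub continuous_const)).norm
  rw [hDo.frontier_eq] at hz
  refine le_antisymm ?_ (not_lt.1 fun h => hz.2 ((hmem z).2 h))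
  exact le_on_closure (f := fun z => ‖L.symm (z - c)‖) (g := fun _ => 1)
    (fun z hz => ((hmem z).1 hz).le) hcont.continuousOn continuousOn_const hz.1

theorem IsEllipsoid.busemannConvexOn {V : Type*} [NormedAddCommGroup V] [NormedSpace ℝ V]
    {D : Set V} (hDo : IsOpen D) {dH : V → V → ℝ} (hdH : IsHilbertMetric D dH)
    (hD : IsEllipsoid D) : BusemannConvexOn D dH := by
  obtain ⟨L, c, hD⟩ := hD
  obtain ⟨hmem, hfr⟩ := frontier_image_ball_subset L c hDo hD
  have hlift : ∀ x ∈ D, OnHyperboloid (hyperboloidLift (L.symm (x - c))) := fun x hx =>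
    onHyperboloid_hyperboloidLift ((hmem x).1 hx)
  have hdist : ∀ x ∈ D, ∀ y ∈ D, dH x y =
      2 * hyperboloidDist (hyperboloidLift (L.symm (x - c))) (hyperboloidLift (L.symm (y - c))) := by
    intro x hx y hy
    rcases eq_or_ne x y with rfl | hxy
    · rw [hdH.1 x hx, (hlift x hx).dist_self, mul_zero]
    obtain ⟨α, β, hα, hβ, ha, hb, h⟩ := hdH.exists_chord hDo hx hy hxy
    rw [h]
    refine log_crossRatio_eq_two_mul_hyperboloidDist hα hβ
      (fun h => hxy (sub_left_injective (L.symm.injective h))) ?_ ?_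
    · rw [← hfr _ ha, ← map_sub, ← map_smul, ← map_sub]
      congr 2
      module
    · rw [← hfr _ hb, ← map_sub, ← map_smul, ← map_add]
      congr 2
      module
  intro γ γ' hγ hγ' t ht
  have h0 : (0 : ℝ) ∈ Set.Icc (0 : ℝ) 1 := by simp
  have h1 : (1 : ℝ) ∈ Set.Icc (0 : ℝ) 1 := by simp
  have hpt : ∀ γ : ℝ → V, IsGeodesicSegment D dH γ →
      IsHyperbolicPoint (hyperboloidLift (L.symm (γ 0 - c))) (hyperboloidLift (L.symm (γ 1 - c)))
        (hyperboloidLift (L.symm (γ t - c))) t := by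
    intro γ hγ
    have e1 := hγ.2 0 h0 t ht
    have e2 := hγ.2 t ht 1 h1
    rw [hdist _ (hγ.1 0 h0) _ (hγ.1 t ht), hdist _ (hγ.1 0 h0) _ (hγ.1 1 h1), zero_sub, abs_neg,
      abs_of_nonneg ht.1] at e1
    rw [hdist _ (hγ.1 t ht) _ (hγ.1 1 h1), hdist _ (hγ.1 0 h0) _ (hγ.1 1 h1), abs_sub_comm,
      abs_of_nonneg (by linarith [ht.2])] at e2
    exact ⟨hlift _ (hγ.1 t ht), by linarith, by linarith⟩
  have := IsHyperbolicPoint.dist_le_convexCombination (hlift _ (hγ.1 0 h0)) (hlift _ (hγ.1 1 h1))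
    (hlift _ (hγ'.1 0 h0)) (hlift _ (hγ'.1 1 h1)) ht.1 ht.2 (hpt γ hγ) (hpt γ' hγ')
  rw [hdist _ (hγ.1 t ht) _ (hγ'.1 t ht), hdist _ (hγ.1 0 h0) _ (hγ'.1 0 h0),
    hdist _ (hγ.1 1 h1) _ (hγ'.1 1 h1)]
  linarith

section Polar

variable {W : Type*} [AddCommGroup W] [Module ℝ W]

/-- `l` is the polar functional of `P` with respect to the cone `C`: the harmonic reflection
`X ↦ 2 l(X) P - X` fixes `P` and preserves `C`. -/
def IsPolar (C : Set W) (P : W) (l : W →ₗ[ℝ] ℝ) : Prop :=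
  l P = 1 ∧ ∀ X ∈ C, (2 * l X) • P - X ∈ C

/-- The harmonic reflection with center `P` and axis the kernel of `l`. -/
def harmonicReflection (P : W) (l : W →ₗ[ℝ] ℝ) : W →ₗ[ℝ] W :=
  (2 • l).smulRight P - LinearMap.id

theorem harmonicReflection_apply (P : W) (l : W →ₗ[ℝ] ℝ) (X : W) :
    harmonicReflection P l X = (2 * l X) • P - X := by
  simp [harmonicReflection]

theorem IsPolar.harmonicReflection_mem {C : Set W} {P X : W} {l : W →ₗ[ℝ] ℝ} (h : IsPolar C P l)
    (hX : X ∈ C) : harmonicReflection P l X ∈ C := by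
  rw [harmonicReflection_apply]
  exact h.2 X hX

theorem harmonicReflection_involutive {P : W} {l : W →ₗ[ℝ] ℝ} (h : l P = 1) (X : W) :
    harmonicReflection P l (harmonicReflection P l X) = X := by
  simp only [harmonicReflection_apply, map_sub, map_smul, h]
  module

theorem IsPolar.smul {C : Set W} {P : W} {l : W →ₗ[ℝ] ℝ} (h : IsPolar C P l) {c : ℝ}
    (hc : c ≠ 0) : IsPolar C (c • P) (c⁻¹ • l) := by
  refine ⟨by simp [h.1, hc], fun X hX => ?_⟩
  have := h.2 X hX
  convert this using 2
  rw [smul_smul]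
  congr 1
  simp only [LinearMap.smul_apply, smul_eq_mul]
  field_simp

theorem IsPolar.comp_harmonicReflection {C : Set W} {P Q : W} {l m : W →ₗ[ℝ] ℝ}
    (hP : IsPolar C P l) (hQ : IsPolar C Q m) :
    IsPolar C (harmonicReflection Q m P) (l ∘ₗ harmonicReflection Q m) := by
  refine ⟨by simp [harmonicReflection_involutive hQ.1, hP.1], fun X hX => ?_⟩
  have := hQ.harmonicReflection_mem (hP.2 _ (hQ.harmonicReflection_mem hX))
  rwa [map_sub, map_smul, harmonicReflection_involutive hQ.1] at this

theorem IsPolar.le_of_isPolar {C : Set W} {τ : W →ₗ[ℝ] ℝ} (hτ : ∀ X ∈ C, 0 < τ X) {P : W}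
    (hP : P ∈ C) {l l' : W →ₗ[ℝ] ℝ} (h : IsPolar C P l) (h' : IsPolar C P l') {X : W}
    (hX : X ∈ C) : l X ≤ l' X := by
  have key : ∀ n : ℕ, X + ((n : ℝ) * (2 * (l' X - l X))) • P ∈ C := by
    intro n
    induction n with
    | zero => simpa using hX
    | succ n ih =>
      have := h.2 _ (h'.2 _ ih)
      simp only [map_add, map_sub, map_smul, h.1, h'.1, smul_eq_mul] at this
      convert this using 1
      push_cast
      module
  by_contra! hlt
  obtain ⟨n, hn⟩ := exists_nat_gt (τ X / ((2 * (l X - l' X)) * τ P))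
  have hpos : 0 < (2 * (l X - l' X)) * τ P := mul_pos (by linarith) (hτ P hP)
  rw [div_lt_iff₀ hpos] at hn
  have := hτ _ (key n)
  simp only [map_add, map_smul, smul_eq_mul] at this
  linarith

/-- `X` is a boundary vector of the convex cone `C`. -/
def IsConeBoundary (C : Set W) (X : W) : Prop := X ∉ C ∧ ∀ Y ∈ C, X + Y ∈ C

theorem IsConeBoundary.smul {C : Set W} (hsmul : ∀ X ∈ C, ∀ c : ℝ, 0 < c → c • X ∈ C) {X : W}
    (h : IsConeBoundary C X) {c : ℝ} (hc : 0 < c) : IsConeBoundary C (c • X) := by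
  refine ⟨fun h' => h.1 ?_, fun Y hY => ?_⟩
  · simpa [smul_smul, hc.ne'] using hsmul _ h' c⁻¹ (by positivity)
  · have := hsmul _ (h.2 _ (hsmul Y hY c⁻¹ (by positivity))) c hc
    simpa [smul_smul, hc.ne'] using this

theorem IsPolar.apply_boundary_ge {C : Set W} (hsmul : ∀ X ∈ C, ∀ c : ℝ, 0 < c → c • X ∈ C)
    {X X' : W} (hX : IsConeBoundary C X) (hX' : IsConeBoundary C X') {l : W →ₗ[ℝ] ℝ}
    (hR : X + X' ∈ C) (h : IsPolar C (X + X') l) : 1 / 2 ≤ l X := by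
  by_contra! hlt
  have he : 0 < 1 - 2 * l X := by linarith
  have := h.2 _ (hX.2 _ (hsmul _ hR _ he))
  simp only [map_add, map_smul, smul_eq_mul] at this
  have h1 : l X' = 1 - l X := by
    have := h.1
    rw [map_add] at this
    linarith
  rw [h1] at this
  refine hX'.1 ?_
  convert this using 1
  module

theorem IsPolar.apply_boundary {C : Set W} (hsmul : ∀ X ∈ C, ∀ c : ℝ, 0 < c → c • X ∈ C)
    {X X' : W} (hX : IsConeBoundary C X) (hX' : IsConeBoundary C X') {l : W →ₗ[ℝ] ℝ}
    (hR : X + X' ∈ C) (h : IsPolar C (X + X') l) : l X = 1 / 2 ∧ l X' = 1 / 2 := by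
  have h1 := h.apply_boundary_ge hsmul hX hX' hR
  have h2 := (add_comm X X' ▸ h).apply_boundary_ge hsmul hX' hX (add_comm X X' ▸ hR)
  have h3 := h.1
  rw [map_add] at h3
  constructor <;> linarith

theorem IsPolar.apply_boundary_smul {C : Set W}
    (hsmul : ∀ X ∈ C, ∀ c : ℝ, 0 < c → c • X ∈ C) {X X' : W} (hX : IsConeBoundary C X)
    (hX' : IsConeBoundary C X') {α β : ℝ} (hα : 0 < α) (hβ : 0 < β) {l : W →ₗ[ℝ] ℝ}
    (hR : α • X + β • X' ∈ C) (h : IsPolar C (α • X + β • X') l) :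
    l X = 1 / (2 * α) ∧ l X' = 1 / (2 * β) := by
  obtain ⟨h1, h2⟩ := h.apply_boundary hsmul (hX.smul hsmul hα) (hX'.smul hsmul hβ) hR
  rw [map_smul, smul_eq_mul] at h1 h2
  constructor
  · field_simp
    linarith
  · field_simp
    linarith

/-- Two points on a chord of a cone are swapped, up to scaling, by a harmonic reflection. -/
theorem exists_harmonicReflection_eq_smul {C : Set W} (hadd : ∀ X ∈ C, ∀ Y ∈ C, X + Y ∈ C)
    (hsmul : ∀ X ∈ C, ∀ c : ℝ, 0 < c → c • X ∈ C) {l : W → W →ₗ[ℝ] ℝ}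
    (hl : ∀ P ∈ C, IsPolar C P (l P)) {X X' : W} (hX : IsConeBoundary C X)
    (hX' : IsConeBoundary C X') {α β α' β' : ℝ} (hα : 0 < α) (hβ : 0 < β) (hα' : 0 < α')
    (hβ' : 0 < β') (hP : α • X + β • X' ∈ C) (hQ : α' • X + β' • X' ∈ C) :
    ∃ c : ℝ, 0 < c ∧ ∃ R ∈ C,
      harmonicReflection R (l R) (α • X + β • X') = c • (α' • X + β' • X') := by
  set c := √(α * β / (α' * β')) with hc
  have hcpos : 0 < c := Real.sqrt_pos.2 (by positivity)
  have hcsq : c ^ 2 * (α' * β') = α * β := by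
    rw [hc, Real.sq_sqrt (by positivity)]
    field_simp
  have hRmem := hadd _ hP _ (hsmul _ hQ c hcpos)
  have hReq : α • X + β • X' + c • (α' • X + β' • X') =
      (α + c * α') • X + (β + c * β') • X' := by module
  rw [hReq] at hRmem
  refine ⟨c, hcpos, _, hRmem, ?_⟩
  obtain ⟨h1, h2⟩ := (hl _ hRmem).apply_boundary_smul hsmul hX hX' (by positivity)
    (by positivity) hRmem
  rw [harmonicReflection_apply]
  generalize l ((α + c * α') • X + (β + c * β') • X') = m at *
  have hs1 : 0 < α + c * α' := by positivity
  have hs2 : 0 < β + c * β' := by positivity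
  have hv : 2 * m (α • X + β • X') = α / (α + c * α') + β / (β + c * β') := by
    rw [map_add, map_smul, map_smul, h1, h2, smul_eq_mul, smul_eq_mul]
    field_simp
  have e1 : (α / (α + c * α') + β / (β + c * β')) * (α + c * α') - α = c * α' := by
    field_simp
    linear_combination (-1 : ℝ) * hcsq
  have e2 : (α / (α + c * α') + β / (β + c * β')) * (β + c * β') - β = c * β' := by
    field_simp
    linear_combination (-1 : ℝ) * hcsq
  rw [hv]
  generalize α / (α + c * α') + β / (β + c * β') = K at *
  rw [show K • ((α + c * α') • X + (β + c * β') • X') - (α • X + β • X') =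
    (K * (α + c * α') - α) • X + (K * (β + c * β') - β) • X' by module, e1, e2]
  module

end Polar

section ConeVolume

variable {W : Type*} [NormedAddCommGroup W] [NormedSpace ℝ W]

theorem IsPolar.unique {C : Set W} (hCo : IsOpen C) {τ : W →ₗ[ℝ] ℝ} (hτ : ∀ X ∈ C, 0 < τ X)
    {P : W} (hP : P ∈ C) {l l' : W →ₗ[ℝ] ℝ} (h : IsPolar C P l) (h' : IsPolar C P l') :
    l = l' := by
  have heq : ∀ X ∈ C, l X = l' X := fun X hX =>
    le_antisymm (h.le_of_isPolar hτ hP h' hX) (h'.le_of_isPolar hτ hP h hX)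
  ext v
  have hcont : Continuous fun ε : ℝ => P + ε • v := by fun_prop
  have hev : ∀ᶠ ε : ℝ in nhds 0, P + ε • v ∈ C :=
    hcont.continuousAt.eventually_mem (hCo.mem_nhds (by simpa using hP))
  obtain ⟨ε, hε, hεpos⟩ := ((hev.filter_mono nhdsWithin_le_nhds).and
    (self_mem_nhdsWithin (s := Set.Ioi (0 : ℝ)))).exists
  have := heq _ hε
  rw [map_add, map_add, heq P hP, map_smul, map_smul, add_right_inj] at this
  exact smul_right_injective ℝ (ne_of_gt hεpos) this

theorem IsPolar.eq_smul_comp {C : Set W} (hCo : IsOpen C) {τ : W →ₗ[ℝ] ℝ}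
    (hτ : ∀ X ∈ C, 0 < τ X) {P Q R : W} (hP : P ∈ C) {l m n : W →ₗ[ℝ] ℝ}
    (hl : IsPolar C P l) (hm : IsPolar C Q m) (hn : IsPolar C R n) {c : ℝ} (hc : 0 < c)
    (h : harmonicReflection R n P = c • Q) : m = c • (l ∘ₗ harmonicReflection R n) := by
  have h1 := hl.comp_harmonicReflection hn
  have h2 := hm.smul hc.ne'
  rw [← h] at h2
  rw [h1.unique hCo hτ (hn.harmonicReflection_mem hP) h2, smul_smul, mul_inv_cancel₀ hc.ne',
    one_smul]

theorem harmonicReflection_abs_det {P : W} {l : W →ₗ[ℝ] ℝ} (h : l P = 1) :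
    |LinearMap.det (harmonicReflection P l)| = 1 := by
  have hcomp : harmonicReflection P l ∘ₗ harmonicReflection P l = LinearMap.id :=
    LinearMap.ext (harmonicReflection_involutive h)
  have := congrArg LinearMap.det hcomp
  rw [LinearMap.det_comp, LinearMap.det_id] at this
  rcases mul_self_eq_one_iff.1 this with h | h <;> simp [h]

variable [FiniteDimensional ℝ W]

open scoped Pointwise in
/-- The volume of the part of a cone cut off by a polar hyperplane is compatible with harmonic
reflections. -/
theorem exists_polar_volume {C : Set W} (hCo : IsOpen C)
    (hsmul : ∀ X ∈ C, ∀ c : ℝ, 0 < c → c • X ∈ C) {τ : W →ₗ[ℝ] ℝ} (hτ : ∀ X ∈ C, 0 < τ X)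
    (hbdd : ∀ r : ℝ, Bornology.IsBounded {X ∈ C | τ X < r}) {l : W → W →ₗ[ℝ] ℝ}
    (hl : ∀ P ∈ C, IsPolar C P (l P)) :
    ∃ v : W → ℝ, (∀ P ∈ C, 0 < v P) ∧ ∀ P ∈ C, ∀ Q ∈ C, ∀ R ∈ C, ∀ c : ℝ, 0 < c →
      harmonicReflection R (l R) P = c • Q → v P = c ^ Module.finrank ℝ W * v Q := by
  borelize W
  let μ : MeasureTheory.Measure W := MeasureTheory.Measure.addHaar
  refine ⟨fun P => (μ {X ∈ C | l P X < 1}).toReal, fun P hP => ?_, ?_⟩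
  · refine ENNReal.toReal_pos ?_ ?_
    · have hopen : IsOpen {X ∈ C | l P X < 1} :=
        hCo.inter (isOpen_lt (l P).continuous_of_finiteDimensional continuous_const)
      refine (hopen.measure_pos μ ⟨(1 / 2 : ℝ) • P, hsmul P hP _ (by norm_num), ?_⟩).ne'
      rw [map_smul, (hl P hP).1]
      norm_num
    · refine ((hbdd (2 * τ P)).subset fun X hX => ⟨hX.1, ?_⟩).measure_lt_top.ne
      have h1 := hτ _ ((hl P hP).2 X hX.1)
      rw [map_sub, map_smul, smul_eq_mul] at h1
      nlinarith [hτ P hP, hX.2]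
  · intro P hP Q hQ R hR c hc h
    have heq := IsPolar.eq_smul_comp hCo hτ hP (hl P hP) (hl Q hQ) (hl R hR) hc h
    have hset : harmonicReflection R (l R) ⁻¹' {X ∈ C | l P X < 1} =
        c • {X ∈ C | l Q X < 1} := by
      ext X
      rw [Set.mem_smul_set_iff_inv_smul_mem₀ hc.ne', Set.mem_preimage]
      simp only [Set.mem_ofPred_eq, map_smul, smul_eq_mul]
      rw [heq]
      simp only [LinearMap.smul_apply, LinearMap.comp_apply, smul_eq_mul,
        inv_mul_cancel_left₀ hc.ne']
      refine and_congr_left fun _ => ⟨fun hX => ?_, fun hX => ?_⟩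
      · have := (hl R hR).harmonicReflection_mem hX
        rw [harmonicReflection_involutive (hl R hR).1] at this
        exact hsmul _ this _ (by positivity)
      · have := hsmul _ hX c hc
        rw [smul_smul, mul_inv_cancel₀ hc.ne', one_smul] at this
        exact (hl R hR).harmonicReflection_mem this
    have habs := harmonicReflection_abs_det (hl R hR).1
    have hdet : LinearMap.det (harmonicReflection R (l R)) ≠ 0 := fun h0 => by
      simp [h0] at habs
    have hvol := MeasureTheory.Measure.addHaar_preimage_linearMap μ hdet {X ∈ C | l P X < 1}
    rw [hset, MeasureTheory.Measure.addHaar_smul, abs_inv, habs, inv_one, ENNReal.ofReal_one,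
      one_mul] at hvol
    simp only
    rw [← hvol, ENNReal.toReal_mul, ENNReal.toReal_ofReal (abs_nonneg _),
      abs_of_nonneg (by positivity)]

/-- A cone whose points all have polar functionals carries a bilinear form inducing the polarity. -/
theorem exists_bilinForm_of_isPolar {C : Set W} (hCo : IsOpen C)
    (hadd : ∀ X ∈ C, ∀ Y ∈ C, X + Y ∈ C)
    (hsmul : ∀ X ∈ C, ∀ c : ℝ, 0 < c → c • X ∈ C) {τ : W →ₗ[ℝ] ℝ} (hτ : ∀ X ∈ C, 0 < τ X)
    (hbdd : ∀ r : ℝ, Bornology.IsBounded {X ∈ C | τ X < r}) {l : W → W →ₗ[ℝ] ℝ}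
    (hl : ∀ P ∈ C, IsPolar C P (l P)) {S : Set W} (hSC : S ⊆ C) (hS : Submodule.span ℝ S = ⊤)
    (hchord : ∀ P ∈ S, ∀ Q ∈ S, P ≠ Q → ∃ X X' : W, IsConeBoundary C X ∧ IsConeBoundary C X' ∧
      ∃ α β α' β' : ℝ, 0 < α ∧ 0 < β ∧ 0 < α' ∧ 0 < β' ∧ P = α • X + β • X' ∧
        Q = α' • X + β' • X') :
    ∃ B : W →ₗ[ℝ] W →ₗ[ℝ] ℝ, (∀ X Y, B X Y = B Y X) ∧
      ∀ P ∈ S, ∃ w : ℝ, 0 < w ∧ B P = w • l P := by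
  obtain ⟨v, hv, hvR⟩ := exists_polar_volume hCo hsmul hτ hbdd hl
  set N := Module.finrank ℝ W
  rcases Nat.eq_zero_or_pos N with hN | hN
  · have : Subsingleton W := Module.finrank_zero_iff.1 hN
    refine ⟨0, by simp, fun P _ => ⟨1, one_pos, LinearMap.ext fun X => ?_⟩⟩
    rw [Subsingleton.elim X 0]
    simp
  let w : W → ℝ := fun P => (v P ^ ((N : ℝ)⁻¹)) ^ 2
  have hw : ∀ P ∈ C, 0 < w P := fun P hP => by
    have := Real.rpow_pos_of_pos (hv P hP) (N : ℝ)⁻¹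
    positivity
  have hsymm : ∀ P ∈ S, ∀ Q ∈ S, w P * l P Q = w Q * l Q P := by
    intro P hPS Q hQS
    rcases eq_or_ne P Q with rfl | hPQ
    · rfl
    have hP := hSC hPS
    have hQ := hSC hQS
    obtain ⟨X, X', hX, hX', α, β, α', β', hα, hβ, hα', hβ', hPX, hQX⟩ := hchord P hPS Q hQS hPQ
    obtain ⟨c, hc, R, hR, h⟩ := exists_harmonicReflection_eq_smul hadd hsmul hl hX hX' hα hβ hα' hβ'
      (hPX ▸ hP) (hQX ▸ hQ)
    rw [← hPX, ← hQX] at h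
    have h1 : l Q P = c ^ 2 * l P Q := by
      rw [IsPolar.eq_smul_comp hCo hτ hP (hl P hP) (hl Q hQ) (hl R hR) hc h]
      simp only [LinearMap.smul_apply, LinearMap.comp_apply, h, map_smul, smul_eq_mul]
      ring
    have h2 : w P = c ^ 2 * w Q := by
      simp only [w]
      rw [hvR P hP Q hQ R hR c hc h, Real.mul_rpow (by positivity) (hv Q hQ).le,
        Real.pow_rpow_inv_natCast hc.le hN.ne']
      ring
    rw [h1, h2]
    ring
  let b := Module.Basis.ofSpan (K := ℝ) hS.ge
  have hbS : ∀ i, b i ∈ S := fun i => Module.Basis.ofSpan_subset hS.ge ⟨i, rfl⟩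
  let B : W →ₗ[ℝ] W →ₗ[ℝ] ℝ := b.constr ℝ fun i => w (b i) • l (b i)
  have hB : ∀ P ∈ S, B P = w P • l P := by
    intro P hP
    refine b.ext fun j => ?_
    have h1 : ∀ X, B X (b j) = (w (b j) • l (b j)) X := by
      intro X
      have : B.flip (b j) = w (b j) • l (b j) := by
        refine b.ext fun i => ?_
        rw [LinearMap.flip_apply]
        simp only [B]
        rw [Module.Basis.constr_basis]
        exact hsymm _ (hbS i) _ (hbS j)
      rw [← this, LinearMap.flip_apply]
    rw [h1]
    exact hsymm _ (hbS j) _ hP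
  refine ⟨B, fun X Y => ?_, fun P hP => ⟨w P, hw P (hSC hP), hB P hP⟩⟩
  have : B = B.flip := by
    refine b.ext fun i => b.ext fun j => ?_
    rw [LinearMap.flip_apply, hB _ (hbS i), hB _ (hbS j)]
    exact hsymm _ (hbS i) _ (hbS j)
  exact congrArg (fun f => f X Y) this

end ConeVolume

section ConeOver

variable {V : Type*} [NormedAddCommGroup V] [NormedSpace ℝ V]

/-- The open cone over `D × {1}`. -/
def coneOver (D : Set V) : Set (V × ℝ) := {X | 0 < X.2 ∧ X.2⁻¹ • X.1 ∈ D}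

theorem mem_coneOver {D : Set V} {X : V × ℝ} :
    X ∈ coneOver D ↔ ∃ p ∈ D, ∃ r : ℝ, 0 < r ∧ X = r • (p, 1) := by
  constructor
  · intro h
    refine ⟨_, h.2, X.2, h.1, Prod.ext ?_ ?_⟩
    · simp [smul_smul, h.1.ne']
    · simp
  · rintro ⟨p, hp, r, hr, rfl⟩
    exact ⟨by simpa using hr, by simpa [smul_smul, hr.ne'] using hp⟩

theorem mk_one_mem_coneOver {D : Set V} {p : V} : (p, (1 : ℝ)) ∈ coneOver D ↔ p ∈ D := by
  simp [coneOver]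

theorem smul_mem_coneOver {D : Set V} {X : V × ℝ} (hX : X ∈ coneOver D) {c : ℝ} (hc : 0 < c) :
    c • X ∈ coneOver D := by
  obtain ⟨p, hp, r, hr, rfl⟩ := mem_coneOver.1 hX
  exact mem_coneOver.2 ⟨p, hp, c * r, by positivity, smul_smul _ _ _⟩

theorem add_mem_coneOver {D : Set V} (hDc : Convex ℝ D) {X Y : V × ℝ} (hX : X ∈ coneOver D)
    (hY : Y ∈ coneOver D) : X + Y ∈ coneOver D := by
  obtain ⟨p, hp, r, hr, rfl⟩ := mem_coneOver.1 hX
  obtain ⟨q, hq, s, hs, rfl⟩ := mem_coneOver.1 hY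
  refine mem_coneOver.2 ⟨_, hDc hp hq (div_pos hr (add_pos hr hs)).le
    (div_pos hs (add_pos hr hs)).le (by field_simp), r + s, by positivity, Prod.ext ?_ ?_⟩
  · have : r + s ≠ 0 := by positivity
    simp only [Prod.fst_add, Prod.smul_fst, smul_add, smul_smul]
    rw [mul_div_cancel₀ _ this, mul_div_cancel₀ _ this]
  · simp

theorem isOpen_coneOver {D : Set V} (hDo : IsOpen D) : IsOpen (coneOver D) := by
  have hc : ContinuousOn (fun X : V × ℝ => X.2⁻¹ • X.1) {X | 0 < X.2} :=
    (continuousOn_snd.inv₀ fun X hX => ne_of_gt hX).smul continuousOn_fst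
  exact hc.isOpen_inter_preimage (isOpen_lt continuous_const continuous_snd) hDo

theorem isBounded_coneOver_lt {D : Set V} (hDb : Bornology.IsBounded D) (r : ℝ) :
    Bornology.IsBounded {X ∈ coneOver D | X.2 < r} := by
  obtain ⟨M, hM⟩ := hDb.exists_norm_le
  refine isBounded_iff_forall_norm_le.2 ⟨max (r * M) r, ?_⟩
  rintro X ⟨hX, hXr⟩
  obtain ⟨p, hp, s, hs, rfl⟩ := mem_coneOver.1 hX
  have hsr : s < r := by simpa using hXr
  have hp' := hM p hp
  rw [Prod.norm_def]
  refine max_le_max ?_ ?_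
  · simp only [Prod.smul_fst, norm_smul, Real.norm_eq_abs, abs_of_pos hs]
    exact mul_le_mul hsr.le hp' (norm_nonneg _) (by linarith)
  · simp only [Prod.smul_snd, smul_eq_mul, mul_one, Real.norm_eq_abs, abs_of_pos hs]
    exact hsr.le

theorem exists_pos_add_smul_mem {D : Set V} (hDo : IsOpen D) {p : V} (hp : p ∈ D) (v : V) :
    ∃ ε : ℝ, 0 < ε ∧ p + ε • v ∈ D := by
  have hcont : Continuous fun ε : ℝ => p + ε • v := by fun_prop
  have hev : ∀ᶠ ε : ℝ in nhds 0, p + ε • v ∈ D :=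
    hcont.continuousAt.eventually_mem (hDo.mem_nhds (by simpa using hp))
  obtain ⟨ε, hε, hεpos⟩ := ((hev.filter_mono nhdsWithin_le_nhds).and
    (self_mem_nhdsWithin (s := Set.Ioi (0 : ℝ)))).exists
  exact ⟨ε, hεpos, hε⟩

theorem span_image_mk_one {D : Set V} (hDo : IsOpen D) (hDn : D.Nonempty) :
    Submodule.span ℝ ((fun p : V => (p, (1 : ℝ))) '' D) = ⊤ := by
  obtain ⟨p, hp⟩ := hDn
  rw [Submodule.eq_top_iff']
  rintro ⟨v, r⟩
  obtain ⟨ε, hε, hmem⟩ := exists_pos_add_smul_mem hDo hp (v - r • p)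
  have h1 := Submodule.subset_span (R := ℝ) (Set.mem_image_of_mem (fun p : V => (p, (1 : ℝ))) hp)
  have h2 := Submodule.subset_span (R := ℝ) (Set.mem_image_of_mem (fun p : V => (p, (1 : ℝ))) hmem)
  have : ((v, r) : V × ℝ) = r • (p, (1 : ℝ)) +
      ε⁻¹ • ((p + ε • (v - r • p), (1 : ℝ)) - (p, (1 : ℝ))) := by
    refine Prod.ext ?_ ?_
    · simp [smul_smul, hε.ne']
    · simp
  rw [this]
  exact add_mem (Submodule.smul_mem _ _ h1) (Submodule.smul_mem _ _ (sub_mem h2 h1))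

theorem isConeBoundary_coneOver {D : Set V} (hDo : IsOpen D) (hDc : Convex ℝ D) {a : V}
    (ha : a ∈ frontier D) : IsConeBoundary (coneOver D) (a, 1) := by
  rw [hDo.frontier_eq] at ha
  refine ⟨fun h => ha.2 (mk_one_mem_coneOver.1 h), fun Y hY => ?_⟩
  obtain ⟨p, hp, r, hr, rfl⟩ := mem_coneOver.1 hY
  have h := hDc.combo_closure_interior_mem_interior ha.1 (hDo.interior_eq.symm ▸ hp)
    (a := 1 / (1 + r)) (b := r / (1 + r)) (by positivity) (by positivity) (by field_simp)
  rw [hDo.interior_eq] at h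
  refine mem_coneOver.2 ⟨_, h, 1 + r, by positivity, Prod.ext ?_ ?_⟩
  · have : 1 + r ≠ 0 := by positivity
    simp only [Prod.fst_add, Prod.smul_fst, smul_add, smul_smul]
    rw [mul_div_cancel₀ _ this, mul_div_cancel₀ _ this, one_smul]
  · simp

variable [FiniteDimensional ℝ V]

theorem exists_bilinForm_of_isPolar_coneOver {D : Set V} (hDo : IsOpen D) (hDc : Convex ℝ D)
    (hDb : Bornology.IsBounded D) (hDn : D.Nonempty)
    (hchord : ∀ p ∈ D, ∀ q ∈ D, p ≠ q → ∃ α β : ℝ, 0 < α ∧ 0 < β ∧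
      p - α • (q - p) ∈ frontier D ∧ q + β • (q - p) ∈ frontier D)
    (hpolar : ∀ p ∈ D, ∃ l, IsPolar (coneOver D) (p, 1) l) :
    ∃ B : V × ℝ →ₗ[ℝ] V × ℝ →ₗ[ℝ] ℝ, (∀ X Y, B X Y = B Y X) ∧
      (∀ p ∈ D, 0 < B (p, 1) (p, 1)) ∧
      ∀ p ∈ D, ∀ u : V, u ≠ 0 → ∃ s t : ℝ, 0 < s ∧ 0 < t ∧ p + t • u ∈ frontier D ∧
        B (p - s • u, 1) (p - s • u, 1) = 0 ∧ B (p + t • u, 1) (p + t • u, 1) = 0 := by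
  have hpolar' : ∀ P : V × ℝ, ∃ l, P ∈ coneOver D → IsPolar (coneOver D) P l := by
    intro P
    by_cases hP : P ∈ coneOver D
    · obtain ⟨p, hp, r, hr, rfl⟩ := mem_coneOver.1 hP
      obtain ⟨l, hl⟩ := hpolar p hp
      exact ⟨_, fun _ => hl.smul hr.ne'⟩
    · exact ⟨0, fun h => absurd h hP⟩
  choose l hl using hpolar'
  have hdecomp : ∀ p q : V, ∀ α β : ℝ, 0 < α → 0 < β →
      (p, (1 : ℝ)) = ((1 + β) / (1 + α + β)) • (p - α • (q - p), (1 : ℝ)) +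
        (α / (1 + α + β)) • (q + β • (q - p), (1 : ℝ)) ∧
      (q, (1 : ℝ)) = (β / (1 + α + β)) • (p - α • (q - p), (1 : ℝ)) +
        ((1 + α) / (1 + α + β)) • (q + β • (q - p), (1 : ℝ)) := by
    intro p q α β hα hβ
    have hT : 1 + α + β ≠ 0 := by positivity
    refine ⟨Prod.ext ?_ ?_, Prod.ext ?_ ?_⟩
    · simp only [Prod.fst_add, Prod.smul_fst]
      match_scalars <;> field_simp <;> ring
    · simp only [Prod.snd_add, Prod.smul_snd, smul_eq_mul]
      field_simp
      ring
    · simp only [Prod.fst_add, Prod.smul_fst]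
      match_scalars <;> field_simp <;> ring
    · simp only [Prod.snd_add, Prod.smul_snd, smul_eq_mul]
      field_simp
      ring
  have hsmul : ∀ X ∈ coneOver D, ∀ c : ℝ, 0 < c → c • X ∈ coneOver D :=
    fun X hX c hc => smul_mem_coneOver hX hc
  obtain ⟨B, hBs, hB⟩ := exists_bilinForm_of_isPolar (C := coneOver D) (l := l)
    (τ := LinearMap.snd ℝ V ℝ) (isOpen_coneOver hDo)
    (fun X hX Y hY => add_mem_coneOver hDc hX hY) hsmul
    (fun X hX => hX.1) (fun r => isBounded_coneOver_lt hDb r) (fun P hP => hl P hP)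
    (S := (fun p : V => (p, (1 : ℝ))) '' D)
    (by rintro _ ⟨p, hp, rfl⟩; exact mk_one_mem_coneOver.2 hp) (span_image_mk_one hDo hDn) (by
      rintro _ ⟨p, hp, rfl⟩ _ ⟨q, hq, rfl⟩ hpq
      obtain ⟨α, β, hα, hβ, ha, hb⟩ := hchord p hp q hq (fun h => hpq (by rw [h]))
      obtain ⟨h1, h2⟩ := hdecomp p q α β hα hβ
      exact ⟨_, _, isConeBoundary_coneOver hDo hDc ha, isConeBoundary_coneOver hDo hDc hb,
        _, _, _, _, by positivity, by positivity, by positivity, by positivity, h1, h2⟩)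
  refine ⟨B, hBs, fun p hp => ?_, fun p hp u hu => ?_⟩
  · obtain ⟨w, hw, h⟩ := hB _ ⟨p, hp, rfl⟩
    rw [h, LinearMap.smul_apply, (hl _ (mk_one_mem_coneOver.2 hp)).1]
    simpa using hw
  · obtain ⟨ε, hε, hq⟩ := exists_pos_add_smul_mem hDo hp u
    set q := p + ε • u with hqdef
    have hpq : p ≠ q := fun h => by
      rw [hqdef, left_eq_add, smul_eq_zero] at h
      exact h.elim hε.ne' hu
    obtain ⟨α, β, hα, hβ, ha, hb⟩ := hchord p hp q hq hpq
    have hT : 0 < 1 + α + β := by positivity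
    obtain ⟨h1, h2⟩ := hdecomp p q α β hα hβ
    have key : ∀ r ∈ D, ∀ x y : ℝ, 0 < x → 0 < y →
        (r, (1 : ℝ)) = x • (p - α • (q - p), (1 : ℝ)) + y • (q + β • (q - p), (1 : ℝ)) →
        x ^ 2 * B (p - α • (q - p), (1 : ℝ)) (p - α • (q - p), (1 : ℝ)) =
          y ^ 2 * B (q + β • (q - p), (1 : ℝ)) (q + β • (q - p), (1 : ℝ)) := by
      intro r hr x y hx hy hxy
      have hX := isConeBoundary_coneOver hDo hDc ha
      have hY := isConeBoundary_coneOver hDo hDc hb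
      obtain ⟨w, hw, h⟩ := hB _ ⟨r, hr, rfl⟩
      have hmem := mk_one_mem_coneOver.2 hr
      rw [hxy] at hmem
      simp only [hxy] at h
      generalize (p - α • (q - p), (1 : ℝ)) = X at *
      generalize (q + β • (q - p), (1 : ℝ)) = Y at *
      obtain ⟨e1, e2⟩ := (hl _ hmem).apply_boundary_smul hsmul hX hY hx hy hmem
      have e3 := congrArg (fun f => f X) h
      have e4 := congrArg (fun f => f Y) h
      simp only [map_add, map_smul, LinearMap.add_apply, LinearMap.smul_apply, smul_eq_mul] at e3 e4
      rw [e1, hBs Y X] at e3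
      rw [e2] at e4
      have e5 : x * (w * (1 / (2 * x))) = y * (w * (1 / (2 * y))) := by field_simp
      rw [← e3, ← e4] at e5
      linear_combination e5
    have k1 := key p hp _ _ (by positivity) (by positivity) h1
    have k2 := key q hq _ _ (by positivity) (by positivity) h2
    have e1 : p - α • (q - p) = p - (α * ε) • u := by
      rw [hqdef]
      module
    have e2 : q + β • (q - p) = p + (ε * (1 + β)) • u := by
      rw [hqdef]
      module
    rw [e2] at hb
    rw [e1, e2] at k1 k2
    have hzero : ∀ x z : ℝ, ((1 + β) / (1 + α + β)) ^ 2 * x = (α / (1 + α + β)) ^ 2 * z →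
        (β / (1 + α + β)) ^ 2 * x = ((1 + α) / (1 + α + β)) ^ 2 * z → x = 0 ∧ z = 0 := by
      intro x z k1 k2
      field_simp at k1 k2
      have hx : x = 0 := by
        have : x * ((1 + β) * (1 + α) - α * β) * ((1 + β) * (1 + α) + α * β) = 0 := by
          linear_combination (1 + α) ^ 2 * k1 - α ^ 2 * k2
        have h3 : (1 + β) * (1 + α) - α * β ≠ 0 := by
          have : (1 + β) * (1 + α) - α * β = 1 + α + β := by ring
          rw [this]
          exact hT.ne'
        have h4 : (1 + β) * (1 + α) + α * β ≠ 0 := by positivity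
        simpa [h3, h4] using this
      rw [hx] at k2
      have : (1 + α) ^ 2 ≠ 0 := by positivity
      exact ⟨hx, by simpa [this] using k2.symm⟩
    exact ⟨α * ε, ε * (1 + β), by positivity, by positivity, hb, hzero _ _ k1 k2⟩

end ConeOver

section Ellipsoid

theorem exists_linearEquiv_euclideanSpace {V : Type*} [AddCommGroup V] [Module ℝ V]
    [FiniteDimensional ℝ V] (M : V →ₗ[ℝ] V →ₗ[ℝ] ℝ) (hs : ∀ x y, M x y = M y x)
    (hpos : ∀ x, x ≠ 0 → 0 < M x x) :
    ∃ L : EuclideanSpace ℝ (Fin (Module.finrank ℝ V)) ≃ₗ[ℝ] V, ∀ u, M (L u) (L u) = ‖u‖ ^ 2 := by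
  let core : InnerProductSpace.Core ℝ V :=
    { inner := fun x y => M x y
      conj_inner_symm := fun x y => by simp [hs x y]
      re_inner_nonneg := fun x => by
        rcases eq_or_ne x 0 with rfl | hx
        · simp
        · simpa using (hpos x hx).le
      add_left := fun x y z => by simp
      smul_left := fun x y r => by simp
      definite := fun x hx => by
        by_contra h
        exact (hpos x h).ne' hx }
  let _ : NormedAddCommGroup V := core.toNormedAddCommGroup
  let _ : InnerProductSpace ℝ V := .ofCore core.toCore
  let b := stdOrthonormalBasis ℝ V
  refine ⟨b.repr.symm.toLinearEquiv, fun u => ?_⟩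
  have h : M (b.repr.symm u) (b.repr.symm u) = inner ℝ (b.repr.symm u) (b.repr.symm u) := rfl
  rw [real_inner_self_eq_norm_sq, LinearIsometryEquiv.norm_map] at h
  exact h

theorem isEllipsoid_of_bilinForm {V : Type*} [NormedAddCommGroup V] [NormedSpace ℝ V]
    [FiniteDimensional ℝ V] {D : Set V} (hDo : IsOpen D) (hDc : Convex ℝ D) (hDn : D.Nonempty)
    {B : V × ℝ →ₗ[ℝ] V × ℝ →ₗ[ℝ] ℝ} (hBs : ∀ X Y, B X Y = B Y X)
    (hBpos : ∀ p ∈ D, 0 < B (p, 1) (p, 1))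
    (hB : ∀ p ∈ D, ∀ u : V, u ≠ 0 → ∃ s t : ℝ, 0 < s ∧ 0 < t ∧ p + t • u ∈ frontier D ∧
        B (p - s • u, 1) (p - s • u, 1) = 0 ∧ B (p + t • u, 1) (p + t • u, 1) = 0) :
    IsEllipsoid D := by
  have hline : ∀ p u : V, ∀ s : ℝ, B (p + s • u, 1) (p + s • u, 1) =
      B (p, 1) (p, 1) + 2 * s * B (p, 1) (u, 0) + s ^ 2 * B (u, 0) (u, 0) := by
    intro p u s
    have : ((p + s • u, 1) : V × ℝ) = (p, 1) + s • (u, 0) := by simp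
    rw [this]
    simp only [map_add, map_smul, LinearMap.add_apply, LinearMap.smul_apply, smul_eq_mul]
    rw [hBs (u, 0) (p, 1)]
    ring
  obtain ⟨p₀, hp₀⟩ := hDn
  have hneg : ∀ u : V, u ≠ 0 → B (u, 0) (u, 0) < 0 := by
    intro u hu
    obtain ⟨s, t, hs, ht, -, h1, h2⟩ := hB p₀ hp₀ u hu
    rw [sub_eq_add_neg, ← neg_smul, hline] at h1
    rw [hline] at h2
    have h3 := hBpos p₀ hp₀
    by_contra! h4
    have h5 : (s + t) * (B (p₀, 1) (p₀, 1) + s * t * B (u, 0) (u, 0)) = 0 := by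
      linear_combination t * h1 + s * h2
    have : 0 < (s + t) * (B (p₀, 1) (p₀, 1) + s * t * B (u, 0) (u, 0)) := by positivity
    linarith
  have hD : ∀ z, z ∈ D ↔ 0 < B (z, 1) (z, 1) := by
    refine fun z => ⟨hBpos z, fun hz => ?_⟩
    by_contra hzD
    have hu : z - p₀ ≠ 0 := fun h => hzD (by rwa [sub_eq_zero.1 h])
    obtain ⟨s, t, hs, ht, hf, -, h2⟩ := hB p₀ hp₀ _ hu
    rcases le_or_gt t 1 with h1 | h1
    · have hz' := hline p₀ (z - p₀) 1
      rw [one_smul, add_sub_cancel] at hz'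
      rw [hz'] at hz
      rw [hline] at h2
      have h3 := hneg _ hu
      have h4 := hBpos p₀ hp₀
      rcases h1.lt_or_eq with h1 | rfl
      · nlinarith [mul_pos ht hz, mul_pos (sub_pos.2 h1) h4,
          mul_neg_of_pos_of_neg (mul_pos ht (sub_pos.2 h1)) h3]
      · linarith
    · refine hzD ?_
      rw [hDo.frontier_eq] at hf
      have h := hDc.combo_closure_interior_mem_interior hf.1 (hDo.interior_eq.symm ▸ hp₀)
        (a := 1 / t) (b := 1 - 1 / t) (by positivity)
        (by rw [sub_pos, div_lt_one ht]; exact h1) (by ring)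
      rw [hDo.interior_eq] at h
      convert h using 1
      match_scalars <;> field_simp
      ring
  let ι := LinearMap.inl ℝ V ℝ
  let M : V →ₗ[ℝ] V →ₗ[ℝ] ℝ := -(B.compl₁₂ ι ι)
  have hM : ∀ x y, M x y = -B (x, 0) (y, 0) := fun x y => rfl
  have hMs : ∀ x y, M x y = M y x := fun x y => by rw [hM, hM, hBs]
  have hMpos : ∀ x, x ≠ 0 → 0 < M x x := fun x hx => by
    rw [hM]
    linarith [hneg x hx]
  have hMinj : Function.Injective M := by
    refine (injective_iff_map_eq_zero M).2 fun x hx => ?_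
    by_contra h
    have := hMpos x h
    rw [hx] at this
    simp at this
  have hMsurj : Function.Surjective M :=
    (LinearMap.injective_iff_surjective_of_finrank_eq_finrank
      (Subspace.dual_finrank_eq (K := ℝ) (V := V)).symm).1 hMinj
  obtain ⟨c, hc⟩ := hMsurj (B (0, 1) ∘ₗ ι)
  have hcenter : ∀ x, B (c + x, 1) (c + x, 1) = B (c, 1) (c, 1) - M x x := by
    intro x
    have h1 := hline c x 1
    rw [one_smul] at h1
    have h2 : B (c, 1) (x, 0) = 0 := by
      have h3 : ((c, 1) : V × ℝ) = (0, 1) + (c, 0) := by simp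
      have h4 : M c x = B (0, 1) (x, 0) := congrArg (fun f => f x) hc
      rw [hM] at h4
      rw [h3, map_add, LinearMap.add_apply, ← h4]
      ring
    rw [h1, h2, hM]
    ring
  have hcpos : 0 < B (c, 1) (c, 1) := by
    have h1 := hBpos p₀ hp₀
    have h2 := hcenter (p₀ - c)
    rw [add_sub_cancel] at h2
    have h3 : 0 ≤ M (p₀ - c) (p₀ - c) := by
      rcases eq_or_ne (p₀ - c) 0 with h | h
      · simp [h]
      · exact (hMpos _ h).le
    linarith
  obtain ⟨L, hL⟩ := exists_linearEquiv_euclideanSpace ((B (c, 1) (c, 1))⁻¹ • M)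
    (fun x y => by simp [hMs x y])
    (fun x hx => by simpa using mul_pos (inv_pos.2 hcpos) (hMpos x hx))
  refine ⟨L, c, Set.ext fun z => ?_⟩
  have hball : ∀ u, c + L u ∈ D ↔ ‖u‖ < 1 := by
    intro u
    have h1 := hL u
    simp only [LinearMap.smul_apply, smul_eq_mul] at h1
    rw [hD, hcenter, show M (L u) (L u) = B (c, 1) (c, 1) * ‖u‖ ^ 2 by rw [← h1]; field_simp]
    rw [← sq_lt_one_iff₀ (norm_nonneg u)]
    constructor <;> intro h <;> nlinarith
  simp only [Set.mem_image, mem_ball_zero_iff, ← hball]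
  constructor
  · intro hz
    exact ⟨L.symm (z - c), by simpa using hz, by simp⟩
  · rintro ⟨u, hu, rfl⟩
    exact hu

end Ellipsoid

/-- If the odd part of the gauge of `D` centered at `p` is linear, then `(p, 1)` has a polar
functional with respect to the cone over `D`. -/
theorem exists_isPolar_of_gauge_sub {V : Type*} [NormedAddCommGroup V] [NormedSpace ℝ V]
    {D : Set V} {p : V} {f : V → ℝ} (hf : ∀ x, p + x ∈ D ↔ f x < 1) (hf0 : ∀ x, 0 ≤ f x)
    (hsmul : ∀ c : ℝ, 0 ≤ c → ∀ x, f (c • x) = c * f x) {ℓ : V →ₗ[ℝ] ℝ}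
    (hℓ : ∀ x, f x - f (-x) = ℓ x) : ∃ l, IsPolar (coneOver D) (p, 1) l := by
  refine ⟨LinearMap.snd ℝ V ℝ - (1 / 2 : ℝ) • ℓ ∘ₗ
    (LinearMap.fst ℝ V ℝ - (LinearMap.snd ℝ V ℝ).smulRight p), by simp, fun X hX => ?_⟩
  obtain ⟨q, hq, r, hr, rfl⟩ := mem_coneOver.1 hX
  obtain ⟨x, rfl⟩ : ∃ x, q = p + x := ⟨q - p, by abel⟩
  have hx := (hf x).1 hq
  have hx' := hf0 (-x)
  have hc : 0 < 1 - ℓ x := by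
    rw [← hℓ]
    linarith
  refine mem_coneOver.2 ⟨p + (1 - ℓ x)⁻¹ • (-x), (hf _).2 ?_, r * (1 - ℓ x), by positivity, ?_⟩
  · rw [hsmul _ (by positivity), ← hℓ, inv_mul_lt_one₀ (by rwa [hℓ])]
    linarith
  · have h : (r * (1 - ℓ x)) * (1 - ℓ x)⁻¹ = r := by field_simp
    refine Prod.ext ?_ ?_
    · simp only [LinearMap.sub_apply, LinearMap.snd_apply, LinearMap.smul_apply,
        LinearMap.comp_apply, LinearMap.fst_apply, LinearMap.smulRight_apply, Prod.fst_sub,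
        Prod.smul_fst, smul_eq_mul, map_sub, map_smul, map_add, smul_add, smul_smul, h]
      match_scalars <;> ring
    · simp only [LinearMap.sub_apply, LinearMap.snd_apply, LinearMap.smul_apply,
        LinearMap.comp_apply, LinearMap.fst_apply, LinearMap.smulRight_apply, Prod.snd_sub,
        Prod.smul_snd, smul_eq_mul, map_sub, map_smul, map_add, mul_one]
      ring

section GaugeHilbert

variable {V : Type*} [NormedAddCommGroup V] [NormedSpace ℝ V]

/-- `f` is an asymmetric norm: subadditive, positively homogeneous and positive definite. -/
structure IsAsymNorm (f : V → ℝ) : Prop where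
  add_le : ∀ x y, f (x + y) ≤ f x + f y
  smul : ∀ c : ℝ, 0 ≤ c → ∀ x, f (c • x) = c * f x
  pos : ∀ x, x ≠ 0 → 0 < f x

/-- `d` is the Hilbert metric of the open unit ball of the asymmetric norm `f`. -/
structure IsGaugeHilbertMetric (f : V → ℝ) (d : V → V → ℝ) : Prop where
  self : ∀ x, f x < 1 → d x x = 0
  chord : ∀ x y, f x < 1 → f y < 1 → x ≠ y → ∃ α β : ℝ, 0 < α ∧ 0 < β ∧
    f (x - α • (y - x)) = 1 ∧ f (y + β • (y - x)) = 1 ∧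
    d x y = Real.log ((1 + α) * (1 + β) / (α * β))

variable {f : V → ℝ} {d : V → V → ℝ}

theorem IsAsymNorm.zero (hf : IsAsymNorm f) : f 0 = 0 := by
  simpa using hf.smul 0 le_rfl 0

theorem IsAsymNorm.add_smul_lt_one (hf : IsAsymNorm f) {c v : V} {s t : ℝ} (hc : f c < 1)
    (hs : 0 < s) (hst : s < t) (ht : f (c + t • v) ≤ 1) : f (c + s • v) < 1 := by
  have ht0 : 0 < t := hs.trans hst
  have h1 : c + s • v = (1 - s / t) • c + (s / t) • (c + t • v) := by
    match_scalars <;> field_simp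
    ring
  have h2 : 0 < 1 - s / t := by
    rw [sub_pos, div_lt_one ht0]
    exact hst
  rw [h1]
  refine (hf.add_le _ _).trans_lt ?_
  rw [hf.smul _ h2.le, hf.smul _ (by positivity)]
  have h3 : 0 < s / t := by positivity
  nlinarith

theorem IsAsymNorm.eq_of_add_smul_eq_one (hf : IsAsymNorm f) {c v : V} {s t : ℝ} (hc : f c < 1)
    (hs : 0 < s) (ht : 0 < t) (h1 : f (c + s • v) = 1) (h2 : f (c + t • v) = 1) : s = t := by
  rcases lt_trichotomy s t with h | h | h
  · exact absurd h1 (hf.add_smul_lt_one hc hs h h2.le).ne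
  · exact h
  · exact absurd h2 (hf.add_smul_lt_one hc ht h h1.le).ne

theorem IsGaugeHilbertMetric.comm (hf : IsAsymNorm f) (hd : IsGaugeHilbertMetric f d) {x y : V}
    (hx : f x < 1) (hy : f y < 1) : d x y = d y x := by
  rcases eq_or_ne x y with rfl | hxy
  · rfl
  obtain ⟨α, β, hα, hβ, h1, h2, h3⟩ := hd.chord x y hx hy hxy
  obtain ⟨α', β', hα', hβ', h1', h2', h3'⟩ := hd.chord y x hy hx hxy.symm
  have e1 : α = β' := by
    refine hf.eq_of_add_smul_eq_one (v := x - y) hx hα hβ' ?_ h2'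
    rw [← h1]
    congr 1
    module
  have e2 : β = α' := by
    refine hf.eq_of_add_smul_eq_one (v := y - x) hy hβ hα' h2 ?_
    rw [← h1']
    congr 1
    module
  rw [h3, h3', e1, e2]
  congr 1
  ring

theorem log_chord {α β : ℝ} (hα : 0 < α) (hβ : 0 < β) :
    Real.log ((1 + α) * (1 + β) / (α * β)) = Real.log (1 + 1 / α) + Real.log (1 + 1 / β) := by
  rw [← Real.log_mul (by positivity) (by positivity)]
  congr 1
  field_simp
  ring

theorem IsGaugeHilbertMetric.dist_le (hf : IsAsymNorm f) (hd : IsGaugeHilbertMetric f d) {a b : V}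
    (ha : f a < 1) (hb : f b < 1) (hab : a ≠ b) {φ φ' : ℝ} (hφ : 0 < φ) (hφ' : 0 < φ')
    (h : f (φ • b + (b - a)) ≤ φ) (h' : f (φ' • a + (a - b)) ≤ φ') :
    d a b ≤ Real.log (1 + φ) + Real.log (1 + φ') := by
  obtain ⟨α, β, hα, hβ, h1, h2, h3⟩ := hd.chord a b ha hb hab
  have key : ∀ {c v : V} {β φ : ℝ}, f c < 1 → 0 < β → 0 < φ → f (c + β • v) = 1 →
      f (φ • c + v) ≤ φ → 1 / β ≤ φ := by
    intro c v β φ hc hβ hφ h1 h2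
    by_contra! hlt
    refine (hf.add_smul_lt_one hc hβ (t := 1 / φ) ?_ ?_).ne h1
    · rw [lt_div_iff₀ hφ]
      rw [lt_div_iff₀ hβ] at hlt
      linarith
    · have : c + (1 / φ) • v = (1 / φ) • (φ • c + v) := by
        rw [smul_add, smul_smul, one_div_mul_cancel hφ.ne', one_smul]
      rw [this, hf.smul _ (by positivity)]
      rw [one_div_mul_eq_div, div_le_one hφ]
      exact h2
  have k1 := key hb hβ hφ h2 h
  have k2 := key (v := a - b) ha hα hφ' (by rw [← h1]; congr 1; module) h'
  rw [h3, log_chord hα hβ, add_comm]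
  exact add_le_add (Real.log_le_log (by positivity) (by linarith))
    (Real.log_le_log (by positivity) (by linarith))

theorem IsGaugeHilbertMetric.le_dist (hf : IsAsymNorm f) (hd : IsGaugeHilbertMetric f d) {a b : V}
    (ha : f a < 1) (hb : f b < 1) (hab : a ≠ b) {z z' : ℝ} (hz : 0 ≤ z) (hz' : 0 ≤ z')
    (h : z * (1 + f (-b)) ≤ f (b - a)) (h' : z' * (1 + f (-a)) ≤ f (a - b)) :
    z / (1 + z) + z' / (1 + z') ≤ d a b := by
  obtain ⟨α, β, hα, hβ, h1, h2, h3⟩ := hd.chord a b ha hb hab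
  have key : ∀ {c v : V} {β z : ℝ}, 0 < β → 0 ≤ z → f (c + β • v) = 1 → 0 ≤ f (-c) →
      z * (1 + f (-c)) ≤ f v → z / (1 + z) ≤ Real.log (1 + 1 / β) := by
    intro c v β z hβ hz h1 h0 h2
    have h3 := hf.add_le (c + β • v) (-c)
    rw [h1, add_neg_cancel_comm, hf.smul _ hβ.le] at h3
    have h4 : z ≤ 1 / β := by
      rw [le_div_iff₀ hβ]
      by_contra! hlt
      nlinarith [mul_lt_mul_of_pos_right hlt (by linarith : 0 < 1 + f (-c))]
    have h5 := Real.one_sub_inv_le_log_of_pos (show 0 < 1 + z by positivity)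
    refine le_trans (le_of_eq ?_) (h5.trans (Real.log_le_log (by positivity) (by linarith)))
    field_simp
    ring
  have hnn : ∀ x, 0 ≤ f x := fun x => by
    rcases eq_or_ne x 0 with rfl | hx
    · exact hf.zero.ge
    · exact (hf.pos x hx).le
  have k1 := key hβ hz h2 (hnn _) h
  have k2 := key (v := a - b) hα hz' (by rw [← h1]; congr 1; module) (hnn _) h'
  rw [h3, log_chord hα hβ]
  linarith

theorem IsGaugeHilbertMetric.dist_ray (hf : IsAsymNorm f) (hd : IsGaugeHilbertMetric f d) {x : V}
    (hx : x ≠ 0) {s t : ℝ} (hs : 0 ≤ s) (hst : s ≤ t) (ht : t * f x < 1) :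
    d (s • x) (t • x) =
      Real.log ((1 + t * f (-x)) / (1 - t * f x) / ((1 + s * f (-x)) / (1 - s * f x))) := by
  have hfx := hf.pos x hx
  have hfx' := hf.pos (-x) (neg_ne_zero.2 hx)
  have hs1 : s * f x < 1 := lt_of_le_of_lt (mul_le_mul_of_nonneg_right hst hfx.le) ht
  have hs2 : f (s • x) < 1 := by rwa [hf.smul s hs]
  have ht2 : f (t • x) < 1 := by rwa [hf.smul t (hs.trans hst)]
  have hs3 : 1 - s * f x ≠ 0 := by linarith
  have ht3 : 1 - t * f x ≠ 0 := by linarith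
  have hs4 : 1 + s * f (-x) ≠ 0 := by positivity
  have ht4 : 1 + t * f (-x) ≠ 0 := by have := hs.trans hst; positivity
  rcases hst.eq_or_lt with rfl | hlt
  · rw [hd.self _ hs2, div_self (div_ne_zero hs4 hs3), Real.log_one]
  have hne : s • x ≠ t • x := fun h => hlt.ne (smul_left_injective ℝ hx h)
  obtain ⟨α, β, hα, hβ, h1, h2, h3⟩ := hd.chord _ _ hs2 ht2 hne
  rw [show t • x + β • (t • x - s • x) = (t + β * (t - s)) • x by module,
    hf.smul _ (by nlinarith)] at h2
  have h1' : (α * (t - s) - s) * f (-x) = 1 := by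
    rcases le_or_gt 0 (s - α * (t - s)) with h | h
    · rw [show s • x - α • (t • x - s • x) = (s - α * (t - s)) • x by module, hf.smul _ h] at h1
      have : α * (t - s) * f x > 0 := mul_pos (mul_pos hα (by linarith)) hfx
      linarith
    · rwa [show s • x - α • (t • x - s • x) = (α * (t - s) - s) • (-x) by module,
        hf.smul _ (by linarith)] at h1
  have hts : t - s ≠ 0 := by linarith
  have eα : α = (1 + s * f (-x)) / ((t - s) * f (-x)) := by
    field_simp
    linarith
  have eβ : β = (1 - t * f x) / ((t - s) * f x) := by
    field_simp
    linarith
  rw [h3]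
  congr 1
  have e1 : (1 + α) / α = (1 + t * f (-x)) / (1 + s * f (-x)) := by
    rw [eα]
    field_simp
    ring
  have e2 : (1 + β) / β = (1 - s * f x) / (1 - t * f x) := by
    rw [eβ]
    field_simp
    ring
  rw [mul_div_mul_comm, e1, e2]
  field_simp

theorem IsAsymNorm.nonneg (hf : IsAsymNorm f) (x : V) : 0 ≤ f x := by
  rcases eq_or_ne x 0 with rfl | hx
  · exact hf.zero.ge
  · exact (hf.pos x hx).le

theorem hasDerivAt_dslope_exp : HasDerivAt (dslope Real.exp 0) (1 / 2) 0 := by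
  refine .of_isLittleO (Asymptotics.IsBigO.trans_isLittleO (g := fun u : ℝ => u ^ 2) ?_ ?_)
  · refine Asymptotics.IsBigO.of_bound 1 ?_
    filter_upwards [Metric.ball_mem_nhds (0 : ℝ) one_pos] with u hu
    rw [mem_ball_zero_iff, Real.norm_eq_abs] at hu
    rcases eq_or_ne u 0 with rfl | hu0
    · simp
    have h := Real.exp_bound hu.le (n := 3) (by norm_num)
    simp only [Finset.sum_range_succ, Finset.sum_range_zero] at h
    norm_num [Nat.factorial] at h
    have hu' : 0 < |u| := abs_pos.2 hu0
    rw [dslope_of_ne _ hu0, dslope_same, Real.deriv_exp, Real.exp_zero, slope_def_field,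
      Real.exp_zero, sub_zero, smul_eq_mul, Real.norm_eq_abs, Real.norm_eq_abs, one_mul, abs_pow]
    have e : (Real.exp u - 1) / u - 1 - u * (1 / 2) = (Real.exp u - (1 + u + u ^ 2 / 2)) / u := by
      field_simp
      ring
    rw [e, abs_div, div_le_iff₀ hu']
    refine h.trans ?_
    nlinarith [pow_pos hu' 3]
  · simp only [sub_zero]
    exact Asymptotics.isLittleO_pow_id one_lt_two

/-- The coefficient `s(t) / t`, where `t ↦ s(t) x` is the geodesic ray from the origin through `x`
with initial velocity `x`. -/
noncomputable def rayCoeff (f : V → ℝ) (x : V) (t : ℝ) : ℝ :=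
  (f x + f (-x)) * dslope Real.exp 0 (t * (f x + f (-x))) /
    (f (-x) + f x * Real.exp (t * (f x + f (-x))))

theorem mul_rayCoeff {V : Type*} [NormedAddCommGroup V] (f : V → ℝ) (x : V) (t : ℝ) :
    t * rayCoeff f x t = (Real.exp (t * (f x + f (-x))) - 1) /
      (f (-x) + f x * Real.exp (t * (f x + f (-x)))) := by
  have h := sub_smul_dslope Real.exp 0 (t * (f x + f (-x)))
  rw [sub_zero, smul_eq_mul, Real.exp_zero] at h
  rw [← h, rayCoeff, ← mul_div_assoc, mul_assoc]

theorem rayCoeff_zero (hf : IsAsymNorm f) {x : V} (hx : x ≠ 0) : rayCoeff f x 0 = 1 := by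
  have h1 := hf.pos x hx
  have h2 := hf.pos (-x) (neg_ne_zero.2 hx)
  rw [rayCoeff, zero_mul, dslope_same, Real.deriv_exp, Real.exp_zero, mul_one, mul_one, add_comm,
    div_self (by positivity)]

theorem hasDerivAt_rayCoeff (hf : IsAsymNorm f) {x : V} (hx : x ≠ 0) :
    HasDerivAt (rayCoeff f x) (-(f x - f (-x)) / 2) 0 := by
  have h1 := hf.pos x hx
  have h2 := hf.pos (-x) (neg_ne_zero.2 hx)
  have h3 : HasDerivAt (fun t : ℝ => t * (f x + f (-x))) (f x + f (-x)) 0 := by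
    simpa using (hasDerivAt_id (0 : ℝ)).mul_const (f x + f (-x))
  have h4 : HasDerivAt (fun t : ℝ => dslope Real.exp 0 (t * (f x + f (-x))))
      (1 / 2 * (f x + f (-x))) 0 :=
    HasDerivAt.comp 0 (by rw [zero_mul]; exact hasDerivAt_dslope_exp) h3
  have h5 := (h4.const_mul (f x + f (-x))).div ((h3.exp.const_mul (f x)).const_add (f (-x)))
    (by positivity)
  refine h5.congr_deriv ?_
  simp only [zero_mul, Real.exp_zero, dslope_same, Real.deriv_exp]
  field_simp
  ring

theorem mul_rayCoeff_nonneg (hf : IsAsymNorm f) {x : V} {t : ℝ} (ht : 0 ≤ t) :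
    0 ≤ t * rayCoeff f x t := by
  have h1 := hf.nonneg x
  have h2 := hf.nonneg (-x)
  rw [mul_rayCoeff]
  have : 1 ≤ Real.exp (t * (f x + f (-x))) := Real.one_le_exp (by positivity)
  exact div_nonneg (by linarith) (by positivity)

theorem one_sub_mul_rayCoeff (hf : IsAsymNorm f) {x : V} (hx : x ≠ 0) (t : ℝ) :
    1 - t * rayCoeff f x t * f x =
      (f x + f (-x)) / (f (-x) + f x * Real.exp (t * (f x + f (-x)))) := by
  have h1 := hf.pos x hx
  have h2 := hf.pos (-x) (neg_ne_zero.2 hx)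
  rw [mul_rayCoeff]
  field_simp
  ring

theorem one_add_mul_rayCoeff (hf : IsAsymNorm f) {x : V} (hx : x ≠ 0) (t : ℝ) :
    1 + t * rayCoeff f x t * f (-x) = (f x + f (-x)) * Real.exp (t * (f x + f (-x))) /
      (f (-x) + f x * Real.exp (t * (f x + f (-x)))) := by
  have h1 := hf.pos x hx
  have h2 := hf.pos (-x) (neg_ne_zero.2 hx)
  rw [mul_rayCoeff]
  field_simp
  ring

theorem apply_ray_lt_one (hf : IsAsymNorm f) {x : V} (hx : x ≠ 0) {t : ℝ} (ht : 0 ≤ t) :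
    f ((t * rayCoeff f x t) • x) < 1 := by
  have h1 := hf.pos x hx
  have h2 := hf.pos (-x) (neg_ne_zero.2 hx)
  rw [hf.smul _ (mul_rayCoeff_nonneg hf ht), ← sub_pos, one_sub_mul_rayCoeff hf hx]
  positivity

theorem mul_rayCoeff_mono (hf : IsAsymNorm f) {x : V} (hx : x ≠ 0) {s t : ℝ} (hst : s ≤ t) :
    s * rayCoeff f x s ≤ t * rayCoeff f x t := by
  have h1 := hf.pos x hx
  have h2 := hf.pos (-x) (neg_ne_zero.2 hx)
  rw [mul_rayCoeff, mul_rayCoeff, div_le_div_iff₀ (by positivity) (by positivity)]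
  have h3 : Real.exp (s * (f x + f (-x))) ≤ Real.exp (t * (f x + f (-x))) :=
    Real.exp_le_exp.2 (mul_le_mul_of_nonneg_right hst (by positivity))
  nlinarith [mul_le_mul_of_nonneg_left h3 h1.le, mul_le_mul_of_nonneg_left h3 h2.le]

theorem IsGaugeHilbertMetric.dist_ray_eq (hf : IsAsymNorm f) (hd : IsGaugeHilbertMetric f d)
    {x : V} (hx : x ≠ 0) {s t : ℝ} (hs : 0 ≤ s) (hst : s ≤ t) :
    d ((s * rayCoeff f x s) • x) ((t * rayCoeff f x t) • x) = (t - s) * (f x + f (-x)) := by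
  have h1 := hf.pos x hx
  have h2 := hf.pos (-x) (neg_ne_zero.2 hx)
  have h3 := apply_ray_lt_one hf hx (hs.trans hst)
  rw [hf.smul _ (mul_rayCoeff_nonneg hf (hs.trans hst))] at h3
  rw [hd.dist_ray hf hx (mul_rayCoeff_nonneg hf hs) (mul_rayCoeff_mono hf hx hst) h3,
    one_add_mul_rayCoeff hf hx, one_add_mul_rayCoeff hf hx, one_sub_mul_rayCoeff hf hx,
    one_sub_mul_rayCoeff hf hx]
  have h4 : ∀ E : ℝ, 0 < E → (f x + f (-x)) * E / (f (-x) + f x * E) /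
      ((f x + f (-x)) / (f (-x) + f x * E)) = E := by
    intro E hE
    field_simp
  rw [h4 _ (Real.exp_pos _), h4 _ (Real.exp_pos _), ← Real.exp_sub, Real.log_exp]
  ring

theorem IsGaugeHilbertMetric.isGeodesicSegment_ray (hf : IsAsymNorm f)
    (hd : IsGaugeHilbertMetric f d) {x : V} (hx : x ≠ 0) {T : ℝ} (hT : 0 ≤ T) :
    IsGeodesicSegment {x | f x < 1} d fun τ => (τ * T * rayCoeff f x (τ * T)) • x := by
  refine ⟨fun t ht => apply_ray_lt_one hf hx (mul_nonneg ht.1 hT), ?_⟩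
  have key : ∀ s ∈ Set.Icc (0 : ℝ) 1, ∀ t ∈ Set.Icc (0 : ℝ) 1, s ≤ t →
      d ((s * T * rayCoeff f x (s * T)) • x) ((t * T * rayCoeff f x (t * T)) • x) =
        (t - s) * (T * (f x + f (-x))) := by
    intro s hs t _ hst
    rw [hd.dist_ray_eq hf hx (mul_nonneg hs.1 hT) (mul_le_mul_of_nonneg_right hst hT)]
    ring
  intro s hs t ht
  simp only
  rw [key 0 (by simp) 1 (by simp) zero_le_one, sub_zero, one_mul]
  rcases le_total s t with h | h
  · rw [key s hs t ht h, abs_sub_comm, abs_of_nonneg (sub_nonneg.2 h)]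
  · rw [hd.comm hf (apply_ray_lt_one hf hx (mul_nonneg hs.1 hT))
      (apply_ray_lt_one hf hx (mul_nonneg ht.1 hT)), key t ht s hs h,
      abs_of_nonneg (sub_nonneg.2 h)]

open Filter Topology in
/-- In a Busemann convex Hilbert geometry geodesic rays from the origin diverge at least
linearly. -/
theorem IsGaugeHilbertMetric.mul_le_dist_ray (hf : IsAsymNorm f) (hfc : Continuous f)
    (hd : IsGaugeHilbertMetric f d) (hb : BusemannConvexOn {x | f x < 1} d) {x y : V} (hx : x ≠ 0)
    (hy : y ≠ 0) (hxy : ∀ s t : ℝ, 0 < s → 0 < t → s • x ≠ t • y) {T : ℝ} (hT : 0 < T) :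
    T * (f (x - y) + f (y - x)) ≤
      d ((T * rayCoeff f y T) • y) ((T * rayCoeff f x T) • x) := by
  have hcx := (hasDerivAt_rayCoeff hf hx).continuousAt
  have hcy := (hasDerivAt_rayCoeff hf hy).continuousAt
  set g : ℝ → ℝ := fun t => f (rayCoeff f x t • x - rayCoeff f y t • y) /
    (1 + f (-((t * rayCoeff f x t) • x))) with hg
  set g' : ℝ → ℝ := fun t => f (rayCoeff f y t • y - rayCoeff f x t • x) /
    (1 + f (-((t * rayCoeff f y t) • y))) with hg'
  have hg0 : ∀ t, 0 ≤ g t := fun t =>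
    div_nonneg (hf.nonneg _) (add_nonneg zero_le_one (hf.nonneg _))
  have hg0' : ∀ t, 0 ≤ g' t := fun t =>
    div_nonneg (hf.nonneg _) (add_nonneg zero_le_one (hf.nonneg _))
  have hgc : ContinuousAt g 0 := by
    refine ContinuousAt.div (hfc.continuousAt.comp (by fun_prop)) (continuousAt_const.add
      (hfc.continuousAt.comp (by fun_prop))) ?_
    have := hf.nonneg (-((0 * rayCoeff f x 0) • x))
    positivity
  have hgc' : ContinuousAt g' 0 := by
    refine ContinuousAt.div (hfc.continuousAt.comp (by fun_prop)) (continuousAt_const.add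
      (hfc.continuousAt.comp (by fun_prop))) ?_
    have := hf.nonneg (-((0 * rayCoeff f y 0) • y))
    positivity
  have hlim : Tendsto (fun t => T * (g t / (1 + t * g t) + g' t / (1 + t * g' t))) (𝓝[>] 0)
      (𝓝 (T * (f (x - y) + f (y - x)))) := by
    have hc : ContinuousAt (fun t => T * (g t / (1 + t * g t) + g' t / (1 + t * g' t))) 0 := by
      refine continuousAt_const.mul ((hgc.div (by fun_prop) (by simp)).add
        (hgc'.div (by fun_prop) (by simp)))
    have h := hc.tendsto.mono_left (nhdsWithin_le_nhds (s := Set.Ioi (0 : ℝ)))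
    have e : T * (g 0 / (1 + 0 * g 0) + g' 0 / (1 + 0 * g' 0)) = T * (f (x - y) + f (y - x)) := by
      simp [hg, hg', rayCoeff_zero hf hx, rayCoeff_zero hf hy, hf.zero]
    rwa [e] at h
  refine le_of_tendsto hlim ?_
  filter_upwards [Ioc_mem_nhdsGT hT] with t ht
  have hγ := hd.isGeodesicSegment_ray hf hx hT.le
  have hη := hd.isGeodesicSegment_ray hf hy hT.le
  have hτ : t / T ∈ Set.Icc (0 : ℝ) 1 := ⟨by have := ht.1; positivity, (div_le_one hT).2 ht.2⟩
  have h := hb _ _ hη hγ _ hτ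
  simp only [div_mul_cancel₀ _ hT.ne', zero_mul, zero_smul, one_mul] at h
  rw [hd.self 0 (by rw [hf.zero]; exact one_pos), mul_zero, zero_add] at h
  have hpos : ∀ z : V, z ≠ 0 → 0 < t * rayCoeff f z t := by
    intro z hz
    have h1 := hf.pos z hz
    have h2 := hf.pos (-z) (neg_ne_zero.2 hz)
    rw [mul_rayCoeff]
    have := ht.1
    have : 1 < Real.exp (t * (f z + f (-z))) := Real.one_lt_exp_iff.2 (by positivity)
    exact div_pos (by linarith) (by positivity)
  have hne : (t * rayCoeff f y t) • y ≠ (t * rayCoeff f x t) • x :=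
    (hxy _ _ (hpos x hx) (hpos y hy)).symm
  have h2 := hd.le_dist hf (apply_ray_lt_one hf hy ht.1.le) (apply_ray_lt_one hf hx ht.1.le) hne
    (mul_nonneg ht.1.le (hg0 t)) (mul_nonneg ht.1.le (hg0' t)) (by
      have h3 : 1 + f (-((t * rayCoeff f x t) • x)) ≠ 0 := by
        have := hf.nonneg (-((t * rayCoeff f x t) • x))
        positivity
      rw [mul_smul, mul_smul, ← smul_sub, hf.smul t ht.1.le, ← mul_smul, hg]
      exact le_of_eq (by field_simp)) (by
      have h3 : 1 + f (-((t * rayCoeff f y t) • y)) ≠ 0 := by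
        have := hf.nonneg (-((t * rayCoeff f y t) • y))
        positivity
      rw [mul_smul t, mul_smul t, ← smul_sub, hf.smul t ht.1.le, ← mul_smul, hg']
      exact le_of_eq (by field_simp))
  have h3 := h2.trans h
  have e1 : t * g t / (1 + t * g t) + t * g' t / (1 + t * g' t) =
      t / T * (T * (g t / (1 + t * g t) + g' t / (1 + t * g' t))) := by
    field_simp
  rw [e1] at h3
  exact le_of_mul_le_mul_left h3 (div_pos ht.1 hT)

open Filter Topology in
theorem eventually_apply_ray_le (hf : IsAsymNorm f) {x y : V} (hx : x ≠ 0) (hy : y ≠ 0)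
    {A : V →L[ℝ] ℝ} (hA : HasFDerivAt f A (x - y)) {c : ℝ}
    (hc : A (f (x - y) • x - ((f x - f (-x)) / 2) • x + ((f y - f (-y)) / 2) • y) < c) :
    ∀ᶠ t in 𝓝[>] (0 : ℝ), f ((t * f (x - y) + t ^ 2 * c) • (t * rayCoeff f x t) • x +
      ((t * rayCoeff f x t) • x - (t * rayCoeff f y t) • y)) ≤ t * f (x - y) + t ^ 2 * c := by
  have hσx := hasDerivAt_rayCoeff hf hx
  have hσy := hasDerivAt_rayCoeff hf hy
  have hx0 := rayCoeff_zero hf hx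
  have hy0 := rayCoeff_zero hf hy
  have hφ : HasDerivAt (fun t : ℝ => t * f (x - y) + t ^ 2 * c) (f (x - y)) 0 := by
    have := ((hasDerivAt_id (0 : ℝ)).mul_const (f (x - y))).fun_add
      ((hasDerivAt_pow 2 (0 : ℝ)).mul_const c)
    simpa using this
  have hk : HasDerivAt (fun t : ℝ => ((t * f (x - y) + t ^ 2 * c) * rayCoeff f x t) • x +
      (rayCoeff f x t • x - rayCoeff f y t • y))
      (f (x - y) • x - ((f x - f (-x)) / 2) • x + ((f y - f (-y)) / 2) • y) 0 := by
    have := ((hφ.mul hσx).smul_const x).add ((hσx.smul_const x).sub (hσy.smul_const y))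
    refine this.congr_deriv ?_
    rw [hx0]
    module
  have hcomp := HasFDerivAt.comp_hasDerivAt (0 : ℝ) (by simpa [hx0, hy0] using hA) hk
  have hev := hcomp.hasDerivWithinAt.limsup_slope_le' (s := Set.Ioi 0) (by simp) hc
  filter_upwards [hev, self_mem_nhdsWithin] with t ht ht0
  have ht0' : 0 < t := ht0
  rw [slope_def_field, sub_zero, div_lt_iff₀ ht0'] at ht
  simp only [Function.comp_apply, hx0, hy0, zero_mul, one_smul, ne_eq, OfNat.ofNat_ne_zero,
    not_false_eq_true, zero_pow, add_zero, zero_smul, zero_add] at ht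
  have e : (t * f (x - y) + t ^ 2 * c) • (t * rayCoeff f x t) • x +
      ((t * rayCoeff f x t) • x - (t * rayCoeff f y t) • y) =
      t • (((t * f (x - y) + t ^ 2 * c) * rayCoeff f x t) • x +
      (rayCoeff f x t • x - rayCoeff f y t • y)) := by module
  rw [e, hf.smul _ ht0'.le]
  nlinarith

open Filter Topology in
theorem IsGaugeHilbertMetric.half_sq_add_half_sq_le (hf : IsAsymNorm f) (hfc : Continuous f)
    (hd : IsGaugeHilbertMetric f d) (hb : BusemannConvexOn {x | f x < 1} d) {x y : V} (hx : x ≠ 0)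
    (hy : y ≠ 0) (hxy : ∀ s t : ℝ, 0 < s → 0 < t → s • x ≠ t • y) {A B : V →L[ℝ] ℝ}
    (hA : HasFDerivAt f A (x - y)) (hB : HasFDerivAt f B (y - x)) {c c' : ℝ}
    (hc : A (f (x - y) • x - ((f x - f (-x)) / 2) • x + ((f y - f (-y)) / 2) • y) < c)
    (hc' : B (f (y - x) • y - ((f y - f (-y)) / 2) • y + ((f x - f (-x)) / 2) • x) < c') :
    f (x - y) ^ 2 / 2 + f (y - x) ^ 2 / 2 ≤ c + c' := by
  have hne : x ≠ y := fun h => hxy 1 1 one_pos one_pos (by rw [h])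
  have hp := hf.pos _ (sub_ne_zero.2 hne)
  have hp' := hf.pos _ (sub_ne_zero.2 hne.symm)
  have h1 := eventually_apply_ray_le hf hx hy hA hc
  have h2 := eventually_apply_ray_le hf hy hx hB hc'
  generalize hF : f (x - y) = F at *
  generalize hF' : f (y - x) = F' at *
  have hpos : ∀ F c : ℝ, 0 < F → ∀ᶠ t in 𝓝[>] (0 : ℝ), 0 < t * F + t ^ 2 * c := by
    intro F c hF
    have hcont : ContinuousAt (fun t : ℝ => F + t * c) 0 := by fun_prop
    have := hcont.eventually_mem (Ioi_mem_nhds (show 0 < F + 0 * c by simpa using hF))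
    filter_upwards [nhdsWithin_le_nhds this, self_mem_nhdsWithin] with t ht ht0
    have := mul_pos (show 0 < t from ht0) (show 0 < F + t * c from ht)
    linarith
  have hlim : Tendsto (fun t : ℝ => c + c' + t * (F * c' + F' * c) + t ^ 2 * (c * c')) (𝓝[>] 0)
      (𝓝 (c + c')) := by
    have hcont : Continuous fun t : ℝ => c + c' + t * (F * c' + F' * c) + t ^ 2 * (c * c') := by
      fun_prop
    have := hcont.continuousAt.tendsto (x := 0)
    simp only [zero_mul, add_zero, ne_eq, OfNat.ofNat_ne_zero, not_false_eq_true, zero_pow] at this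
    exact this.mono_left nhdsWithin_le_nhds
  refine ge_of_tendsto hlim ?_
  filter_upwards [h1, h2, hpos F c hp, hpos F' c' hp', self_mem_nhdsWithin] with t h1 h2 hφ hφ' ht0
  have ht : 0 < t := ht0
  have hpos' : ∀ z : V, z ≠ 0 → 0 < t * rayCoeff f z t := by
    intro z hz
    have h1 := hf.pos z hz
    have h2 := hf.pos (-z) (neg_ne_zero.2 hz)
    rw [mul_rayCoeff]
    have : 1 < Real.exp (t * (f z + f (-z))) := Real.one_lt_exp_iff.2 (by positivity)
    exact div_pos (by linarith) (by positivity)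
  have h3 := hd.mul_le_dist_ray hf hfc hb hx hy hxy ht
  have h4 := hd.dist_le hf (apply_ray_lt_one hf hy ht.le) (apply_ray_lt_one hf hx ht.le)
    (hxy _ _ (hpos' x hx) (hpos' y hy)).symm hφ hφ' h1 h2
  rw [hF, hF'] at h3
  have h5 := h3.trans h4
  rw [← Real.log_mul (by positivity) (by positivity), Real.le_log_iff_exp_le (by positivity)] at h5
  have h6 := (Real.quadratic_le_exp_of_nonneg (x := t * (F + F')) (by positivity)).trans h5
  have h7 : t ^ 2 * (F ^ 2 / 2 + F' ^ 2 / 2) ≤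
      t ^ 2 * (c + c' + t * (F * c' + F' * c) + t ^ 2 * (c * c')) := by
    linear_combination h6
  exact le_of_mul_le_mul_left h7 (by positivity)

theorem IsAsymNorm.apply_of_hasFDerivAt (hf : IsAsymNorm f) {w : V} {A : V →L[ℝ] ℝ}
    (hA : HasFDerivAt f A w) : A w = f w := by
  have h1 : HasDerivAt (fun t : ℝ => t • w) w 1 := by
    simpa using (hasDerivAt_id (1 : ℝ)).smul_const w
  have h2 := HasFDerivAt.comp_hasDerivAt (1 : ℝ) (by simpa using hA) h1
  have h3 : HasDerivAt (fun t : ℝ => t * f w) (f w) 1 := by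
    simpa using (hasDerivAt_id (1 : ℝ)).mul_const (f w)
  refine h2.unique (h3.congr_of_eventuallyEq ?_)
  filter_upwards [Ioi_mem_nhds (zero_lt_one' ℝ)] with t ht
  exact hf.smul t (le_of_lt ht) w

theorem IsGaugeHilbertMetric.apply_sub_le (hf : IsAsymNorm f) (hfc : Continuous f)
    (hd : IsGaugeHilbertMetric f d) (hb : BusemannConvexOn {x | f x < 1} d) {x y : V} (hx : x ≠ 0)
    (hy : y ≠ 0) (hxy : ∀ s t : ℝ, 0 < s → 0 < t → s • x ≠ t • y) {A B : V →L[ℝ] ℝ}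
    (hA : HasFDerivAt f A (x - y)) (hB : HasFDerivAt f B (y - x)) :
    (f x - f (-x)) * (A x - B x) - (f y - f (-y)) * (A y - B y) ≤
      f (x - y) * (A x + A y) + f (y - x) * (B x + B y) := by
  have hAw := hf.apply_of_hasFDerivAt hA
  have hBw := hf.apply_of_hasFDerivAt hB
  rw [map_sub] at hAw hBw
  have key : f (x - y) ^ 2 / 2 + f (y - x) ^ 2 / 2 ≤
      A (f (x - y) • x - ((f x - f (-x)) / 2) • x + ((f y - f (-y)) / 2) • y) +
      B (f (y - x) • y - ((f y - f (-y)) / 2) • y + ((f x - f (-x)) / 2) • x) := by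
    refine le_of_forall_pos_le_add fun ε hε => ?_
    refine (hd.half_sq_add_half_sq_le hf hfc hb hx hy hxy hA hB
      (lt_add_of_pos_right _ (half_pos hε)) (lt_add_of_pos_right _ (half_pos hε))).trans ?_
    exact le_of_eq (by ring)
  simp only [map_add, map_sub, map_smul, smul_eq_mul] at key
  have e1 : A x = f (x - y) + A y := by linarith
  have e2 : B y = f (y - x) + B x := by linarith
  rw [e1, e2] at key ⊢
  linear_combination 2 * key

/-- In a Busemann convex Hilbert geometry, the odd part of the gauge is linear. -/
theorem IsGaugeHilbertMetric.exists_linear (hf : IsAsymNorm f) (hfc : Continuous f)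
    (hd : IsGaugeHilbertMetric f d) (hb : BusemannConvexOn {x | f x < 1} d) {w : V} (hw : w ≠ 0)
    (hA : DifferentiableAt ℝ f w) (hB : DifferentiableAt ℝ f (-w)) :
    ∃ ℓ : V →ₗ[ℝ] ℝ, ∀ x, f x - f (-x) = ℓ x := by
  obtain ⟨A, hA⟩ := hA
  obtain ⟨B, hB⟩ := hB
  have hAw := hf.apply_of_hasFDerivAt hA
  have hBw := hf.apply_of_hasFDerivAt hB
  rw [map_neg] at hBw
  have hp := hf.pos w hw
  have hp' := hf.pos (-w) (neg_ne_zero.2 hw)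
  have hplane : ∀ y, A y = B y → f (w + y) - f (-(w + y)) = A (w + y) + B (w + y) := by
    intro y hy
    rcases eq_or_ne y 0 with rfl | hy0
    · rw [add_zero]
      linarith
    have hAB : 0 < A w - B w := by linarith
    have hx0 : w + y ≠ 0 := fun h => by
      have h1 := congrArg A h
      have h2 := congrArg B h
      rw [map_add, map_zero] at h1 h2
      linarith
    have hxy : ∀ s t : ℝ, 0 < s → s • (w + y) ≠ t • y := fun s t hs h => by
      have h1 := congrArg A h
      have h2 := congrArg B h
      rw [map_smul, map_smul, map_add, smul_eq_mul, smul_eq_mul] at h1 h2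
      rw [← hy] at h2
      have h3 : s * (A w - B w) = 0 := by linarith
      exact (mul_pos hs hAB).ne' h3
    have e1 : w + y - y = w := add_sub_cancel_right w y
    have e2 : y - (w + y) = -w := by abel
    have k1 := hd.apply_sub_le hf hfc hb hx0 hy0 (fun s t hs _ => hxy s t hs) (A := A) (B := B)
      (by rwa [e1]) (by rwa [e2])
    have k2 := hd.apply_sub_le hf hfc hb (neg_ne_zero.2 hx0) (neg_ne_zero.2 hy0)
      (fun s t hs _ h => hxy s t hs (by simpa only [smul_neg, neg_inj] using h)) (A := B) (B := A)
      (by rwa [show -(w + y) - -y = -w by abel]) (by rwa [show -y - -(w + y) = w by abel])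
    rw [e1, e2] at k1
    rw [show -(w + y) - -y = -w by abel, show -y - -(w + y) = w by abel] at k2
    simp only [neg_neg, map_neg, map_add] at k1 k2 ⊢
    rw [← hAw, ← hBw, ← hy] at k1 k2
    have h3 : (A w - B w) * (f (w + y) - f (-(w + y)) - (A w + B w + 2 * A y)) = 0 := by
      linarith
    have h4 := (mul_eq_zero.1 h3).resolve_left hAB.ne'
    linarith
  have hpos : ∀ x, 0 < A x - B x → f x - f (-x) = A x + B x := by
    intro x hx
    have hAB : 0 < A w - B w := by linarith
    set c := (A x - B x) / (A w - B w) with hc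
    have hcpos : 0 < c := div_pos hx hAB
    have hcw : c * (A w - B w) = A x - B x := div_mul_cancel₀ _ hAB.ne'
    have h := hplane (c⁻¹ • x - w) (by
      simp only [map_sub, map_smul, smul_eq_mul]
      have : c⁻¹ * (A x - B x) = A w - B w := by
        rw [← hcw, inv_mul_cancel_left₀ hcpos.ne']
      linarith)
    rw [add_sub_cancel, ← smul_neg, hf.smul _ (by positivity), hf.smul _ (by positivity), map_smul,
      map_smul, smul_eq_mul, smul_eq_mul, ← mul_sub, ← mul_add] at h
    exact mul_left_cancel₀ (inv_ne_zero hcpos.ne') h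
  have hne : ∀ x, A x - B x ≠ 0 → f x - f (-x) = A x + B x := by
    intro x hx
    rcases hx.lt_or_gt with h | h
    · have := hpos (-x) (by rw [map_neg, map_neg]; linarith)
      rw [neg_neg, map_neg, map_neg] at this
      linarith
    · exact hpos x h
  refine ⟨(A + B : V →L[ℝ] ℝ), fun x => ?_⟩
  have hAB : 0 < A w - B w := by linarith
  have hc1 : Continuous fun t : ℝ => f (x + t • w) - f (-(x + t • w)) := by fun_prop
  have hc2 : Continuous fun t : ℝ => A (x + t • w) + B (x + t • w) := by fun_prop
  have hdense : Dense {t : ℝ | A (x + t • w) - B (x + t • w) ≠ 0} := by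
    refine (dense_compl_singleton (-(A x - B x) / (A w - B w))).mono ?_
    intro t ht h
    refine ht ?_
    simp only [map_add, map_smul, smul_eq_mul] at h
    rw [Set.mem_singleton_iff, eq_div_iff hAB.ne']
    linarith
  have heq := congrFun (hc1.ext_on hdense hc2 fun t ht => hne _ ht) 0
  simpa using heq

theorem exists_differentiableAt_neg [FiniteDimensional ℝ V] [Nontrivial V] {K : NNReal}
    (hf : LipschitzWith K f) :
    ∃ w : V, w ≠ 0 ∧ DifferentiableAt ℝ f w ∧ DifferentiableAt ℝ f (-w) := by
  borelize V
  let μ : MeasureTheory.Measure V := MeasureTheory.Measure.addHaar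
  have h1 := hf.ae_differentiableAt (μ := μ)
  have h2 := (hf.comp (LipschitzWith.id.neg (E := V))).ae_differentiableAt (μ := μ)
  obtain ⟨v, hv⟩ := exists_ne (0 : V)
  obtain ⟨w, hw, hw1, hw2⟩ := (MeasureTheory.Measure.dense_of_ae (h1.and h2)).inter_open_nonempty
    {0}ᶜ isOpen_compl_singleton ⟨v, hv⟩
  refine ⟨w, hw, hw1, ?_⟩
  have : DifferentiableAt ℝ ((fun x => f (-x)) ∘ fun x => -x) (-w) :=
    DifferentiableAt.comp (-w) (by rw [neg_neg]; exact hw2) (by fun_prop)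
  simpa [Function.comp_def] using this

end GaugeHilbert

section Gauge

variable {V : Type*} [NormedAddCommGroup V] [NormedSpace ℝ V]

theorem isAsymNorm_gauge {D : Set V} (hDo : IsOpen D) (hDc : Convex ℝ D)
    (hDb : Bornology.IsBounded D) (h0 : 0 ∈ D) : IsAsymNorm (gauge D) where
  add_le := gauge_add_le hDc (absorbent_nhds_zero (hDo.mem_nhds h0))
  smul := fun c hc x => by rw [gauge_smul_of_nonneg hc, smul_eq_mul]
  pos := fun x hx => (gauge_pos (absorbent_nhds_zero (hDo.mem_nhds h0))
    (NormedSpace.isVonNBounded_iff ℝ |>.2 hDb)).2 hx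

/-- The Hilbert metric, recentered at a point `p` of `D`, in terms of the gauge. -/
theorem IsHilbertMetric.isGaugeHilbertMetric {D : Set V} (hDo : IsOpen D) (hDc : Convex ℝ D)
    {d : V → V → ℝ} (hd : IsHilbertMetric D d) {p : V} (hp : p ∈ D) :
    (∀ x, p + x ∈ D ↔ gauge ((p + ·) ⁻¹' D) x < 1) ∧
      IsGaugeHilbertMetric (gauge ((p + ·) ⁻¹' D)) fun x y => d (p + x) (p + y) := by
  have hopen : IsOpen ((p + ·) ⁻¹' D) := hDo.preimage (by fun_prop)
  have hconv : Convex ℝ ((p + ·) ⁻¹' D) := hDc.translate_preimage_right p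
  have h0 : (p + ·) ⁻¹' D ∈ nhds (0 : V) := hopen.mem_nhds (by simpa using hp)
  have hmem : ∀ x, p + x ∈ D ↔ gauge ((p + ·) ⁻¹' D) x < 1 := fun x => by
    rw [gauge_lt_one_iff_mem_interior hconv h0, hopen.interior_eq, Set.mem_preimage]
  have hfr : ∀ x, p + x ∈ frontier D ↔ gauge ((p + ·) ⁻¹' D) x = 1 := fun x => by
    rw [gauge_eq_one_iff_mem_frontier hconv h0]
    have := (Homeomorph.addLeft p).preimage_frontier D
    simp only [Homeomorph.coe_addLeft] at this
    rw [← this, Set.mem_preimage]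
  refine ⟨hmem, fun x hx => hd.1 _ ((hmem x).2 hx), fun x y hx hy hxy => ?_⟩
  obtain ⟨α, β, hα, hβ, h1, h2, h3⟩ := hd.exists_chord hDo ((hmem x).2 hx) ((hmem y).2 hy)
    (fun h => hxy (add_left_cancel h))
  refine ⟨α, β, hα, hβ, (hfr _).1 ?_, (hfr _).1 ?_, h3⟩
  · convert h1 using 1
    module
  · convert h2 using 1
    module

variable [FiniteDimensional ℝ V]

/-- The odd part of the gauge at every point of a Busemann convex Hilbert geometry is linear. -/
theorem BusemannConvexOn.exists_gauge_sub_eq {D : Set V} (hDo : IsOpen D) (hDc : Convex ℝ D)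
    (hDb : Bornology.IsBounded D) {d : V → V → ℝ} (hd : IsHilbertMetric D d)
    (hb : BusemannConvexOn D d) {p : V} (hp : p ∈ D) :
    ∃ ℓ : V →ₗ[ℝ] ℝ, ∀ x, gauge ((p + ·) ⁻¹' D) x - gauge ((p + ·) ⁻¹' D) (-x) = ℓ x := by
  obtain ⟨hmem, hG⟩ := hd.isGaugeHilbertMetric hDo hDc hp
  have hopen : IsOpen ((p + ·) ⁻¹' D) := hDo.preimage (by fun_prop)
  have hconv : Convex ℝ ((p + ·) ⁻¹' D) := hDc.translate_preimage_right p
  have h0 : (0 : V) ∈ (p + ·) ⁻¹' D := by simpa using hp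
  have hbdd : Bornology.IsBounded ((p + ·) ⁻¹' D) :=
    (IsometryEquiv.addLeft p).isometry.antilipschitz.isBounded_preimage hDb
  have hf := isAsymNorm_gauge hopen hconv hbdd h0
  have hb' : BusemannConvexOn {x | gauge ((p + ·) ⁻¹' D) x < 1}
      fun x y => d (p + x) (p + y) := by
    intro γ γ' hγ hγ'
    exact hb (fun t => p + γ t) (fun t => p + γ' t)
      ⟨fun t ht => (hmem _).2 (hγ.1 t ht), hγ.2⟩ ⟨fun t ht => (hmem _).2 (hγ'.1 t ht), hγ'.2⟩
  rcases subsingleton_or_nontrivial V with hV | hV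
  · refine ⟨0, fun x => ?_⟩
    rw [Subsingleton.elim (-x) x]
    simp
  obtain ⟨K, hK⟩ := hconv.lipschitz_gauge (hopen.mem_nhds h0)
  obtain ⟨w, hw, h1, h2⟩ := exists_differentiableAt_neg hK
  exact hG.exists_linear hf hK.continuous hb' hw h1 h2

theorem BusemannConvexOn.isEllipsoid {D : Set V} (hDo : IsOpen D) (hDc : Convex ℝ D)
    (hDb : Bornology.IsBounded D) (hDn : D.Nonempty) {d : V → V → ℝ} (hd : IsHilbertMetric D d)
    (hb : BusemannConvexOn D d) : IsEllipsoid D := by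
  obtain ⟨B, hBs, hBpos, hB⟩ := exists_bilinForm_of_isPolar_coneOver hDo hDc hDb hDn
    (fun p hp q hq hpq => by
      obtain ⟨α, β, hα, hβ, h1, h2, -⟩ := hd.exists_chord hDo hp hq hpq
      exact ⟨α, β, hα, hβ, h1, h2⟩)
    (fun p hp => by
      obtain ⟨ℓ, hℓ⟩ := hb.exists_gauge_sub_eq hDo hDc hDb hd hp
      exact exists_isPolar_of_gauge_sub (hd.isGaugeHilbertMetric hDo hDc hp).1
        (fun x => gauge_nonneg x) (fun c hc x => by rw [gauge_smul_of_nonneg hc, smul_eq_mul]) hℓ)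
  exact isEllipsoid_of_bilinForm hDo hDc hDn hBs hBpos hB

end Gauge

theorem hilbert_metric_busemann_convex_iff_ellipsoid
    {V : Type*} [NormedAddCommGroup V] [NormedSpace ℝ V] [FiniteDimensional ℝ V]
    (D : Set V) (hDo : IsOpen D) (hDc : Convex ℝ D) (hDb : Bornology.IsBounded D)
    (hDn : D.Nonempty)
    (dH : V → V → ℝ) (hdH : IsHilbertMetric D dH) :
    BusemannConvexOn D dH ↔ IsEllipsoid D :=
  ⟨fun hb => hb.isEllipsoid hDo hDc hDb hDn hdH, fun h => h.busemannConvexOn hDo hdH⟩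
end

section
/- Let D be a nonempty bounded convex open subset of a finite-dimensional real normed vector space. If D is an ellipsoid, then the Hilbert metric d_H on D satisfies condition (D): d_H(s·x+(1−s)·y, s·z+(1−s)·w) ≤ max{d_H(x,z), d_H(y,w)} for all x, y, z, w ∈ D and s ∈ [0,1]. -/
open scoped InnerProductSpace

section InnerProduct

variable {E : Type*} [NormedAddCommGroup E] [InnerProductSpace ℝ E]

lemma one_sub_inner_convexComb_sq_le {u v u' v' : E} {s K : ℝ} (hK : 1 ≤ K)
    (hs₀ : 0 ≤ s) (hs₁ : s ≤ 1) (hu : ‖u‖ < 1) (hv : ‖v‖ < 1) (hu' : ‖u'‖ < 1) (hv' : ‖v'‖ < 1)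
    (h : (1 - ⟪u, v⟫_ℝ) ^ 2 ≤ K * ((1 - ‖u‖ ^ 2) * (1 - ‖v‖ ^ 2)))
    (h' : (1 - ⟪u', v'⟫_ℝ) ^ 2 ≤ K * ((1 - ‖u'‖ ^ 2) * (1 - ‖v'‖ ^ 2)))
    (hp : ‖s • u + (1 - s) • u'‖ < 1) (hq : ‖s • v + (1 - s) • v'‖ < 1) :
    (1 - ⟪s • u + (1 - s) • u', s • v + (1 - s) • v'⟫_ℝ) ^ 2 ≤
      K * ((1 - ‖s • u + (1 - s) • u'‖ ^ 2) * (1 - ‖s • v + (1 - s) • v'‖ ^ 2)) := by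
  have pos : ∀ {x : E}, ‖x‖ < 1 → 0 < 1 - ‖x‖ ^ 2 := fun {x} hx => by
    nlinarith [norm_nonneg x]
  obtain ⟨C, hC, rfl⟩ : ∃ C : ℝ, 1 ≤ C ∧ K = C ^ 2 :=
    ⟨√K, Real.one_le_sqrt.2 hK, (Real.sq_sqrt (by linarith)).symm⟩
  obtain ⟨a, ha, haa⟩ : ∃ a : ℝ, 0 < a ∧ a ^ 2 = 1 - ‖s • u + (1 - s) • u'‖ ^ 2 :=
    ⟨_, Real.sqrt_pos.2 (pos hp), Real.sq_sqrt (pos hp).le⟩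
  obtain ⟨b, hb, hbb⟩ : ∃ b : ℝ, 0 < b ∧ b ^ 2 = 1 - ‖s • v + (1 - s) • v'‖ ^ 2 :=
    ⟨_, Real.sqrt_pos.2 (pos hq), Real.sq_sqrt (pos hq).le⟩
  have amgm : ∀ {x y : E}, ‖x‖ < 1 → ‖y‖ < 1 →
      (1 - ⟪x, y⟫_ℝ) ^ 2 ≤ C ^ 2 * ((1 - ‖x‖ ^ 2) * (1 - ‖y‖ ^ 2)) →
      2 * (a * b) * (1 - ⟪x, y⟫_ℝ) ≤
        C * (b ^ 2 * (1 - ‖x‖ ^ 2) + a ^ 2 * (1 - ‖y‖ ^ 2)) := by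
    intro x y hx hy hxy
    have hx := pos hx
    have hy := pos hy
    refine abs_le_of_sq_le_sq' ?_ (by positivity) |>.2
    calc (2 * (a * b) * (1 - ⟪x, y⟫_ℝ)) ^ 2
        = 4 * (a * b) ^ 2 * (1 - ⟪x, y⟫_ℝ) ^ 2 := by ring
      _ ≤ 4 * (a * b) ^ 2 * (C ^ 2 * ((1 - ‖x‖ ^ 2) * (1 - ‖y‖ ^ 2))) := by gcongr
      _ ≤ _ := by
        nlinarith [sq_nonneg (C * (b ^ 2 * (1 - ‖x‖ ^ 2) - a ^ 2 * (1 - ‖y‖ ^ 2)))]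
  have key : 0 ≤ C * (b ^ 2 * ‖u - u'‖ ^ 2 + a ^ 2 * ‖v - v'‖ ^ 2)
      - 2 * (a * b) * ⟪u - u', v - v'⟫_ℝ := by
    have h₁ := real_inner_le_norm (u - u') (v - v')
    have h₂ := mul_le_mul_of_nonneg_left h₁ (by positivity : 0 ≤ 2 * (a * b))
    have h₃ : 0 ≤ (C - 1) * (b ^ 2 * ‖u - u'‖ ^ 2 + a ^ 2 * ‖v - v'‖ ^ 2) :=
      mul_nonneg (by linarith) (by positivity)
    nlinarith [sq_nonneg (b * ‖u - u'‖ - a * ‖v - v'‖)]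
  have e₁ : ∀ x y : E, ‖s • x + (1 - s) • y‖ ^ 2 =
      s * ‖x‖ ^ 2 + (1 - s) * ‖y‖ ^ 2 - s * (1 - s) * ‖x - y‖ ^ 2 := by
    intro x y
    simp only [← real_inner_self_eq_norm_sq, inner_add_left, inner_add_right, inner_sub_left,
      inner_sub_right, real_inner_smul_left, real_inner_smul_right, real_inner_comm x y]
    ring
  have e₂ : ⟪s • u + (1 - s) • u', s • v + (1 - s) • v'⟫_ℝ =
      s * ⟪u, v⟫_ℝ + (1 - s) * ⟪u', v'⟫_ℝ - s * (1 - s) * ⟪u - u', v - v'⟫_ℝ := by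
    simp only [inner_add_left, inner_add_right, inner_sub_left,
      inner_sub_right, real_inner_smul_left, real_inner_smul_right]
    ring
  have h₁ := mul_le_mul_of_nonneg_left (amgm hu hv h) hs₀
  have h₂ := mul_le_mul_of_nonneg_left (amgm hu' hv' h') (sub_nonneg.2 hs₁)
  have h₃ := mul_nonneg (mul_nonneg hs₀ (sub_nonneg.2 hs₁)) key
  have h₄ : 2 * (a * b) * (1 - ⟪s • u + (1 - s) • u', s • v + (1 - s) • v'⟫_ℝ) ≤
      2 * (a * b) * (C * (a * b)) := by
    have h₅ : 2 * (a * b) * (C * (a * b)) = C * (b ^ 2 * a ^ 2 + a ^ 2 * b ^ 2) := by ring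
    rw [h₅]
    nth_rewrite 1 [haa]
    nth_rewrite 2 [hbb]
    rw [e₁, e₁, e₂]
    linarith
  have h₅ : 0 ≤ 1 - ⟪s • u + (1 - s) • u', s • v + (1 - s) • v'⟫_ℝ := by
    have := real_inner_le_norm (s • u + (1 - s) • u') (s • v + (1 - s) • v')
    nlinarith [norm_nonneg (s • u + (1 - s) • u'), norm_nonneg (s • v + (1 - s) • v')]
  rw [← haa, ← hbb]
  have h₆ := le_of_mul_le_mul_left h₄ (by positivity)
  calc _ ≤ (C * (a * b)) ^ 2 := by gcongr
    _ = _ := by ring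

lemma quadratic_of_norm_eq_one_of_sub_eq {u v α : E} {t : ℝ} (hα : ‖α‖ = 1)
    (h : u - α = t • (v - α)) :
    (1 - ‖u‖ ^ 2) - 2 * t * (1 - ⟪u, v⟫_ℝ) + t ^ 2 * (1 - ‖v‖ ^ 2) = 0 := by
  have h₁ : u - t • v = (1 - t) • α := by
    rw [sub_smul, one_smul, ← sub_eq_zero]
    rw [smul_sub, ← sub_eq_zero] at h
    rw [← h]
    abel
  have h₂ : ‖u - t • v‖ ^ 2 = (1 - t) ^ 2 := by
    rw [h₁, norm_smul, hα, mul_one, Real.norm_eq_abs, sq_abs]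
  rw [norm_sub_sq_real, real_inner_smul_right, norm_smul, mul_pow, Real.norm_eq_abs, sq_abs] at h₂
  linarith

lemma cosh_log_inv_mul_of_sub_eq {u v α β : E} {t τ : ℝ}
    (hα : ‖α‖ = 1) (hβ : ‖β‖ = 1) (ht₀ : 0 < t) (ht₁ : t < 1) (hτ₀ : 0 < τ) (hτ₁ : τ < 1)
    (h : u - α = t • (v - α)) (h' : v - β = τ • (u - β)) :
    (Real.cosh (Real.log (t⁻¹ * τ⁻¹)) + 1) / 2 * ((1 - ‖u‖ ^ 2) * (1 - ‖v‖ ^ 2)) =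
      (1 - ⟪u, v⟫_ℝ) ^ 2 := by
  have q₁ := quadratic_of_norm_eq_one_of_sub_eq hα h
  have q₂ := quadratic_of_norm_eq_one_of_sub_eq hβ h'
  rw [real_inner_comm] at q₂
  rw [Real.cosh_log (by positivity)]
  generalize 1 - ‖u‖ ^ 2 = A at *
  generalize 1 - ‖v‖ ^ 2 = B at *
  generalize 1 - ⟪u, v⟫_ℝ = m at *
  have hne : 1 - t * τ ≠ 0 := by nlinarith
  have hA : τ * A = t * B := by
    apply mul_left_cancel₀ hne
    linear_combination τ * q₁ - t * q₂
  have hm : 2 * τ * m = B * (1 + t * τ) := by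
    linear_combination -q₂ + τ * hA
  have hA' : A = t * B / τ := by field_simp; linarith
  have hm' : m = B * (1 + t * τ) / (2 * τ) := by field_simp; linarith
  rw [hA', hm']
  field_simp
  ring

end InnerProduct

lemma exists_sub_eq_smul_of_mem_segment {V : Type*} [NormedAddCommGroup V] [NormedSpace ℝ V]
    {a x y : V} (h : x ∈ segment ℝ a y) (hxa : x ≠ a) (hxy : x ≠ y) :
    ∃ t : ℝ, 0 < t ∧ t < 1 ∧ x - a = t • (y - a) ∧ ‖y - a‖ / ‖x - a‖ = t⁻¹ := by
  rw [segment_eq_image'] at h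
  obtain ⟨t, ⟨ht₀, ht₁⟩, rfl⟩ := h
  have h₀ : t ≠ 0 := by rintro rfl; simp at hxa
  have h₁ : t ≠ 1 := by rintro rfl; simp at hxy
  have hya : y - a ≠ 0 := fun h => by simp [h] at hxa
  refine ⟨t, ht₀.lt_of_ne' h₀, ht₁.lt_of_ne h₁, by simp, ?_⟩
  have := norm_ne_zero_iff.2 hya
  rw [add_sub_cancel_left, norm_smul, Real.norm_of_nonneg ht₀]
  field_simp

lemma IsHilbertMetric.cosh_formula {V E : Type*} [NormedAddCommGroup V] [NormedSpace ℝ V]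
    [NormedAddCommGroup E] [InnerProductSpace ℝ E] {d : V → V → ℝ} (L : E ≃L[ℝ] V) (c : V)
    (hd : IsHilbertMetric ((fun u => c + L u) '' Metric.ball (0 : E) 1) d)
    {u v : E} (hu : ‖u‖ < 1) (hv : ‖v‖ < 1) :
    0 ≤ d (c + L u) (c + L v) ∧
    (Real.cosh (d (c + L u) (c + L v)) + 1) / 2 * ((1 - ‖u‖ ^ 2) * (1 - ‖v‖ ^ 2)) =
      (1 - ⟪u, v⟫_ℝ) ^ 2 := by
  have hmem : ∀ {x : E}, ‖x‖ < 1 → c + L x ∈ (fun u => c + L u) '' Metric.ball (0 : E) 1 :=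
    fun hx => ⟨_, by simpa using hx, rfl⟩
  by_cases huv : u = v
  · subst huv
    rw [hd.1 _ (hmem hu), real_inner_self_eq_norm_sq, Real.cosh_zero]
    exact ⟨le_rfl, by ring⟩
  have hne : c + L u ≠ c + L v := by simpa using huv
  obtain ⟨a, ha, b, hb, hua, hvb, hlog⟩ := hd.2 _ (hmem hu) _ (hmem hv) hne
  have hfr : frontier ((fun u => c + L u) '' Metric.ball (0 : E) 1) =
      (fun u => c + L u) '' Metric.sphere (0 : E) 1 := by
    rw [← frontier_ball (0 : E) one_ne_zero]
    exact ((L.toHomeomorph.trans (Homeomorph.addLeft c)).image_frontier _).symm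
  rw [hfr] at ha hb
  obtain ⟨α, hα, rfl⟩ := ha
  obtain ⟨β, hβ, rfl⟩ := hb
  rw [mem_sphere_zero_iff_norm] at hα hβ
  obtain ⟨t, ht₀, ht₁, ht, htn⟩ := exists_sub_eq_smul_of_mem_segment hua
    (by simp only [ne_eq, add_right_inj, L.injective.eq_iff]; rintro rfl; exact hu.ne hα) hne
  rw [segment_symm] at hvb
  obtain ⟨τ, hτ₀, hτ₁, hτ, hτn⟩ := exists_sub_eq_smul_of_mem_segment hvb
    (by simp only [ne_eq, add_right_inj, L.injective.eq_iff]; rintro rfl; exact hv.ne hβ) hne.symm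
  have pull : ∀ {x y z : E} {r : ℝ}, c + L x - (c + L z) = r • (c + L y - (c + L z)) →
      x - z = r • (y - z) := fun {x y z r} h => by
    apply L.injective
    simpa using h
  rw [hlog, mul_div_mul_comm, htn, hτn]
  refine ⟨Real.log_nonneg ?_, cosh_log_inv_mul_of_sub_eq hα hβ ht₀ ht₁ hτ₀ hτ₁ (pull ht) (pull hτ)⟩
  exact one_le_mul_of_one_le_of_one_le ((one_le_inv₀ ht₀).2 ht₁.le) ((one_le_inv₀ hτ₀).2 hτ₁.le)

theorem hilbert_metric_condition_D_of_ellipsoid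
    {V : Type*} [NormedAddCommGroup V] [NormedSpace ℝ V] [FiniteDimensional ℝ V]
    (D : Set V) (hDo : IsOpen D) (hDc : Convex ℝ D) (hDb : Bornology.IsBounded D)
    (hDn : D.Nonempty)
    (dH : V → V → ℝ) (hdH : IsHilbertMetric D dH)
    (hDell : IsEllipsoid D) :
    ∀ x ∈ D, ∀ y ∈ D, ∀ z ∈ D, ∀ w ∈ D, ∀ s ∈ Set.Icc (0 : ℝ) 1,
      dH (s • x + (1 - s) • y) (s • z + (1 - s) • w) ≤ max (dH x z) (dH y w) := by
  obtain ⟨L₀, c, rfl⟩ := hDell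
  obtain ⟨L, hL⟩ : ∃ L : EuclideanSpace ℝ (Fin (Module.finrank ℝ V)) ≃L[ℝ] V, ⇑L = ⇑L₀ :=
    ⟨L₀.toContinuousLinearEquiv, rfl⟩
  rw [← hL] at hdH
  rintro _ ⟨x, hx, rfl⟩ _ ⟨y, hy, rfl⟩ _ ⟨z, hz, rfl⟩ _ ⟨w, hw, rfl⟩ s ⟨hs₀, hs₁⟩
  have hball := convex_ball (0 : EuclideanSpace ℝ (Fin (Module.finrank ℝ V))) 1
  have hp := hball hx hy hs₀ (sub_nonneg.2 hs₁) (by ring)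
  have hq := hball hz hw hs₀ (sub_nonneg.2 hs₁) (by ring)
  rw [mem_ball_zero_iff] at hx hy hz hw hp hq
  have comb : ∀ u v : EuclideanSpace ℝ (Fin (Module.finrank ℝ V)),
      s • (c + L u) + (1 - s) • (c + L v) = c + L (s • u + (1 - s) • v) := by
    intro u v
    rw [map_add, map_smul, map_smul]
    module
  simp only [← hL, comb]
  obtain ⟨hxz₀, hxz⟩ := hdH.cosh_formula L c hx hz
  obtain ⟨hyw₀, hyw⟩ := hdH.cosh_formula L c hy hw
  obtain ⟨hpq₀, hpq⟩ := hdH.cosh_formula L c hp hq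
  set M := max (dH (c + L x) (c + L z)) (dH (c + L y) (c + L w))
  have pos : ∀ {u : EuclideanSpace ℝ (Fin (Module.finrank ℝ V))}, ‖u‖ < 1 → 0 < 1 - ‖u‖ ^ 2 :=
    fun {u} hu => by nlinarith [norm_nonneg u]
  have mono : ∀ {r : ℝ}, 0 ≤ r → r ≤ M → Real.cosh r ≤ Real.cosh M := fun h h' => by
    rwa [Real.cosh_le_cosh, abs_of_nonneg h, abs_of_nonneg (h.trans h')]
  have := pos hx
  have := pos hy
  have := pos hz
  have := pos hw
  have key := one_sub_inner_convexComb_sq_le (K := (Real.cosh M + 1) / 2)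
    (by linarith [Real.one_le_cosh M]) hs₀ hs₁ hx hz hy hw
    (by rw [← hxz]; gcongr; exact mono hxz₀ (le_max_left _ _))
    (by rw [← hyw]; gcongr; exact mono hyw₀ (le_max_right _ _)) hp hq
  rw [← hpq] at key
  have hcosh := le_of_mul_le_mul_right key (mul_pos (pos hp) (pos hq))
  have hle : Real.cosh (dH (c + L (s • x + (1 - s) • y)) (c + L (s • z + (1 - s) • w))) ≤
      Real.cosh M := by linarith
  rwa [Real.cosh_le_cosh, abs_of_nonneg hpq₀, abs_of_nonneg (hxz₀.trans (le_max_left _ _))] at hle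
end

section
/- Let D be an ellipsoid in a finite-dimensional real normed vector space, equipped with its Hilbert metric d_H, and let F : D → D be nonexpansive with respect to d_H and without fixed points, with family of resolvents {R_λ}_{λ>0}. Then there exists a point ξ ∈ ∂D such that R_λ converges to ξ as λ → ∞, uniformly on every d_H-bounded subset of D: for every bounded set K ⊂ D and every norm-open neighborhood U of ξ in closure(D), there is Λ > 0 such that R_λ(y) ∈ U for all λ ≥ Λ and all y ∈ K. -/
/-- The squared hyperbolic cosine of half the Hilbert distance on the open unit ball. -/
noncomputable def ballCrossRatio {E : Type*} [NormedAddCommGroup E] [InnerProductSpace ℝ E]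
    (u v : E) : ℝ :=
  (1 - inner ℝ u v) ^ 2 / ((1 - ‖u‖ ^ 2) * (1 - ‖v‖ ^ 2))

theorem one_sub_norm_sq_pos {E : Type*} [NormedAddCommGroup E] {u : E} (hu : ‖u‖ < 1) :
    0 < 1 - ‖u‖ ^ 2 := by
  nlinarith [norm_nonneg u]

section Ball

variable {E : Type*} [NormedAddCommGroup E] [InnerProductSpace ℝ E]

theorem one_sub_inner_pos {u v : E} (hu : ‖u‖ < 1) (hv : ‖v‖ ≤ 1) : 0 < 1 - inner ℝ u v := by
  nlinarith [real_inner_le_norm u v, norm_nonneg u, norm_nonneg v]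

theorem eq_of_one_sub_inner_sq_le {u v : E} (hu : ‖u‖ < 1)
    (h : (1 - inner ℝ u v) ^ 2 ≤ (1 - ‖u‖ ^ 2) * (1 - ‖v‖ ^ 2)) : v = u := by
  obtain ⟨w, rfl⟩ : ∃ w, v = u + w := ⟨v - u, by abel⟩
  rw [inner_add_right, real_inner_self_eq_norm_sq, norm_add_sq_real] at h
  have hq := one_sub_norm_sq_pos hu
  have hw : (1 - ‖u‖ ^ 2) * ‖w‖ ^ 2 ≤ 0 := by nlinarith [sq_nonneg (inner ℝ u w)]
  have : ‖w‖ ^ 2 ≤ 0 := by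
    by_contra! hc
    linarith [mul_pos hq hc]
  have : w = 0 := by
    rw [← norm_eq_zero]
    exact pow_eq_zero_iff two_ne_zero |>.1 (le_antisymm this (sq_nonneg _))
  simp [this]

theorem ballCrossRatio_self {u : E} (hu : ‖u‖ < 1) : ballCrossRatio u u = 1 := by
  have := one_sub_norm_sq_pos hu
  rw [ballCrossRatio, real_inner_self_eq_norm_sq, pow_two, div_self (by positivity)]

/-- The quadratic relation expressing that the point dividing a chord lies on the unit sphere. -/
theorem quadratic_of_mem_sphere {u v α : E} {s : ℝ} (hα : ‖α‖ = 1)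
    (h : u = (1 - s) • α + s • v) :
    (1 - ‖u‖ ^ 2) - 2 * s * (1 - inner ℝ u v) + s ^ 2 * (1 - ‖v‖ ^ 2) = 0 := by
  have h1 : u - s • v = (1 - s) • α := by rw [h]; abel
  have h2 : ‖u - s • v‖ ^ 2 = (1 - s) ^ 2 := by
    rw [h1, norm_smul, hα, mul_one, Real.norm_eq_abs, sq_abs]
  rw [norm_sub_sq_real, inner_smul_right, norm_smul, mul_pow, Real.norm_eq_abs, sq_abs] at h2
  linarith

theorem ballCrossRatio_eq_of_chord {u v α β : E} {s r : ℝ} (hu : ‖u‖ < 1) (hv : ‖v‖ < 1)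
    (hα : ‖α‖ = 1) (hβ : ‖β‖ = 1) (hs : 0 < s) (hs1 : s < 1) (hr : 0 < r) (hr1 : r < 1)
    (hsu : u = (1 - s) • α + s • v) (hrv : v = (1 - r) • β + r • u) :
    ballCrossRatio u v = (1 + s * r) ^ 2 / (4 * (s * r)) := by
  have h1 := quadratic_of_mem_sphere hα hsu
  have h2 := quadratic_of_mem_sphere hβ hrv
  have hA := one_sub_norm_sq_pos hu
  have hB := one_sub_norm_sq_pos hv
  rw [real_inner_comm] at h2
  unfold ballCrossRatio
  generalize inner ℝ u v = P at *
  generalize 1 - ‖u‖ ^ 2 = A at *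
  generalize 1 - ‖v‖ ^ 2 = B at *
  have hsr : 0 < 1 - s * r := by nlinarith
  have h3 : r * A = s * B := by
    have : (1 - s * r) * (r * A - s * B) = 0 := by linear_combination r * h1 - s * h2
    rcases mul_eq_zero.1 this with h | h <;> linarith
  have h4 : 2 * s * (1 - P) = A * (1 + s * r) := by linear_combination -h1 - s * h3
  rw [div_eq_div_iff (by positivity) (by positivity)]
  have hB' : B = r * A / s := by field_simp; linarith
  have hP' : 1 - P = A * (1 + s * r) / (2 * s) := by field_simp; linarith
  rw [hB', hP']
  field_simp
  ring

/-- A resolvent of a nonexpansive fixed-point-free self-map of the unit ball leaves every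
smaller ball, uniformly in the base point. -/
theorem resolvent_escapes [ProperSpace E] {f : E → E}
    (hf : ∀ u, ‖u‖ < 1 → ‖f u‖ < 1)
    (hne : ∀ u v, ‖u‖ < 1 → ‖v‖ < 1 → ballCrossRatio (f u) (f v) ≤ ballCrossRatio u v)
    (hfix : ∀ u, ‖u‖ < 1 → f u ≠ u) {ε : ℝ} (hε : 0 < ε) :
    ∃ Λ : ℝ, 0 < Λ ∧ ∀ l : ℝ, Λ ≤ l → ∀ x z : E, ‖x‖ < 1 → ‖z‖ < 1 →
      z = (1 / (1 + l)) • x + (l / (1 + l)) • f z → 1 - ‖z‖ ^ 2 < ε := by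
  by_contra! hcon
  choose l hl x z hx hz heq hzε using fun n : ℕ => hcon (n + 1) (by positivity)
  obtain ⟨y, hy, φ, hφ, hlim⟩ := (isCompact_closedBall (0 : E) 1).tendsto_subseq
    (x := z) (fun n => by simpa using (hz n).le)
  have hyq : ε ≤ 1 - ‖y‖ ^ 2 :=
    ge_of_tendsto' (tendsto_const_nhds.sub (hlim.norm.pow 2)) fun n => hzε (φ n)
  have hy1 : ‖y‖ < 1 := by nlinarith [norm_nonneg y]
  have hsub : Filter.Tendsto (fun n => f (z n) - z n) Filter.atTop (nhds 0) := by
    refine squeeze_zero_norm (a := fun n : ℕ => 2 * (1 / ((n : ℝ) + 1))) (fun n => ?_) ?_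
    · have hl0 : (0 : ℝ) < 1 + l n := by
        linarith [hl n, Nat.cast_nonneg (α := ℝ) n]
      have h1 : f (z n) - z n = (1 / (1 + l n)) • (f (z n) - x n) := by
        have h2 : f (z n) = (1 / (1 + l n)) • f (z n) + (l n / (1 + l n)) • f (z n) := by
          rw [← add_smul, ← add_div, div_self hl0.ne', one_smul]
        rw [smul_sub, sub_eq_sub_iff_add_eq_add]
        nth_rewrite 1 [h2]
        nth_rewrite 4 [heq n]
        abel
      have h3 : ‖f (z n) - x n‖ ≤ 2 := by
        linarith [norm_sub_le (f (z n)) (x n), hf _ (hz n), hx n]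
      rw [h1, norm_smul, Real.norm_of_nonneg (by positivity), mul_comm 2]
      exact mul_le_mul (one_div_le_one_div_of_le (by positivity) (by linarith [hl n])) h3
        (norm_nonneg _) (by positivity)
    · simpa using (tendsto_one_div_add_atTop_nhds_zero_nat (𝕜 := ℝ)).const_mul 2
  have hflim : Filter.Tendsto (fun n => f (z (φ n))) Filter.atTop (nhds y) := by
    simpa using (hsub.comp hφ.tendsto_atTop).add hlim
  have hqy := one_sub_norm_sq_pos hy1
  have hqf := one_sub_norm_sq_pos (hf y hy1)
  have key : ballCrossRatio y (f y) ≤ ballCrossRatio y y := by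
    refine le_of_tendsto_of_tendsto' (f := fun n => ballCrossRatio (f (z (φ n))) (f y))
      (g := fun n => ballCrossRatio (z (φ n)) y) (b := Filter.atTop) ?_ ?_
      (fun n => hne _ _ (hz _) hy1)
    · exact ((tendsto_const_nhds.sub (hflim.inner tendsto_const_nhds)).pow 2).div
        ((tendsto_const_nhds.sub (hflim.norm.pow 2)).mul tendsto_const_nhds) (by positivity)
    · exact ((tendsto_const_nhds.sub (hlim.inner tendsto_const_nhds)).pow 2).div
        ((tendsto_const_nhds.sub (hlim.norm.pow 2)).mul tendsto_const_nhds) (by positivity)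
  rw [ballCrossRatio_self hy1, ballCrossRatio, div_le_one (by positivity)] at key
  exact hfix y hy1 (eq_of_one_sub_inner_sq_le hy1 key)

/-- A Wolff point: a boundary point all of whose horoballs are invariant under `f`. -/
theorem exists_wolff_point [ProperSpace E] {f : E → E}
    (hf : ∀ u, ‖u‖ < 1 → ‖f u‖ < 1)
    (hne : ∀ u v, ‖u‖ < 1 → ‖v‖ < 1 → ballCrossRatio (f u) (f v) ≤ ballCrossRatio u v)
    (hfix : ∀ u, ‖u‖ < 1 → f u ≠ u)
    (hres : ∀ l : ℝ, 0 < l → ∃ z : E, ‖z‖ < 1 ∧ z = (l / (1 + l)) • f z) :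
    ∃ ξ : E, ‖ξ‖ = 1 ∧ ∀ u, ‖u‖ < 1 →
      (1 - inner ℝ (f u) ξ) ^ 2 * (1 - ‖u‖ ^ 2) ≤
        (1 - inner ℝ u ξ) ^ 2 * (1 - ‖f u‖ ^ 2) := by
  choose w hw heq using fun n : ℕ => hres (n + 1) (by positivity)
  obtain ⟨ξ, hξ, φ, hφ, hlim⟩ := (isCompact_closedBall (0 : E) 1).tendsto_subseq
    (x := fun n => f (w n)) (fun n => by simpa using (hf _ (hw n)).le)
  have hlim : Filter.Tendsto (fun n => f (w (φ n))) Filter.atTop (nhds ξ) := hlim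
  have ht : Filter.Tendsto (fun n : ℕ => ((n : ℝ) + 1) / (1 + ((n : ℝ) + 1)))
      Filter.atTop (nhds 1) := by
    have h := (tendsto_natCast_div_add_atTop (1 : ℝ)).comp (Filter.tendsto_add_atTop_nat 1)
    refine h.congr fun n => ?_
    simp [add_comm]
  have hwlim : Filter.Tendsto (fun n => w (φ n)) Filter.atTop (nhds ξ) := by
    have h := (ht.comp hφ.tendsto_atTop).smul hlim
    rw [one_smul] at h
    exact h.congr fun n => (heq (φ n)).symm
  have hξ1 : ‖ξ‖ ≤ 1 := by simpa using hξ
  refine ⟨ξ, le_antisymm hξ1 ?_, fun u hu => ?_⟩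
  · by_contra! hlt
    obtain ⟨Λ, -, hΛ⟩ := resolvent_escapes hf hne hfix (half_pos (one_sub_norm_sq_pos hlt))
    have hev : ∀ᶠ n in Filter.atTop, 1 - ‖w (φ n)‖ ^ 2 < (1 - ‖ξ‖ ^ 2) / 2 := by
      have hat : Filter.Tendsto (fun n => ((φ n : ℕ) : ℝ)) Filter.atTop Filter.atTop :=
        tendsto_natCast_atTop_atTop.comp hφ.tendsto_atTop
      filter_upwards [hat.eventually_ge_atTop Λ] with n hn
      exact hΛ (φ n + 1) (by linarith) 0 _ (by simp) (hw _) (by simpa using heq (φ n))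
    have := le_of_tendsto (tendsto_const_nhds.sub (hwlim.norm.pow 2)) (hev.mono fun _ h => h.le)
    linarith [one_sub_norm_sq_pos hlt]
  · refine le_of_tendsto_of_tendsto'
      (f := fun n => (1 - inner ℝ (f u) (f (w (φ n)))) ^ 2 * (1 - ‖u‖ ^ 2))
      (g := fun n => (1 - inner ℝ u (w (φ n))) ^ 2 * (1 - ‖f u‖ ^ 2)) (b := Filter.atTop) ?_ ?_ ?_
    · exact ((tendsto_const_nhds.sub (tendsto_const_nhds.inner hlim)).pow 2).mul_const _
    · exact ((tendsto_const_nhds.sub (tendsto_const_nhds.inner hwlim)).pow 2).mul_const _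
    · intro n
      have h := hne u (w (φ n)) hu (hw _)
      have hqu := one_sub_norm_sq_pos hu
      have hqf := one_sub_norm_sq_pos (hf u hu)
      have hqw := one_sub_norm_sq_pos (hw (φ n))
      have hqfw := one_sub_norm_sq_pos (hf _ (hw (φ n)))
      have hle : 1 - ‖f (w (φ n))‖ ^ 2 ≤ 1 - ‖w (φ n)‖ ^ 2 := by
        have : ‖w (φ n)‖ ≤ ‖f (w (φ n))‖ := by
          conv_lhs => rw [heq (φ n), norm_smul, Real.norm_of_nonneg (by positivity)]
          refine mul_le_of_le_one_left (norm_nonneg _) ?_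
          rw [div_le_one (by positivity)]
          linarith
        gcongr
      rw [ballCrossRatio, ballCrossRatio, div_le_div_iff₀ (by positivity) (by positivity)] at h
      refine le_of_mul_le_mul_right ?_ hqw
      calc _ = _ := by ring
        _ ≤ _ := h
        _ = (1 - inner ℝ u (w (φ n))) ^ 2 * (1 - ‖f u‖ ^ 2) * (1 - ‖f (w (φ n))‖ ^ 2) := by ring
        _ ≤ _ := by gcongr

theorem combo_sqrt_one_sub_norm_sq_le {u v : E} {s t : ℝ} (hs : 0 ≤ s) (ht : 0 ≤ t)
    (hst : s + t = 1) (hu : ‖u‖ ≤ 1) (hv : ‖v‖ ≤ 1) :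
    s * √(1 - ‖u‖ ^ 2) + t * √(1 - ‖v‖ ^ 2) ≤ √(1 - ‖s • u + t • v‖ ^ 2) := by
  apply Real.le_sqrt_of_sq_le
  have hA : 0 ≤ 1 - ‖u‖ ^ 2 := by nlinarith [norm_nonneg u]
  have hB : 0 ≤ 1 - ‖v‖ ^ 2 := by nlinarith [norm_nonneg v]
  have h1 := Real.sq_sqrt hA
  have h2 := Real.sq_sqrt hB
  rw [norm_add_sq_real, inner_smul_left, inner_smul_right, norm_smul, norm_smul,
    Real.norm_of_nonneg hs, Real.norm_of_nonneg ht]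
  simp only [conj_trivial]
  have h3 := real_inner_le_norm u v
  set a := √(1 - ‖u‖ ^ 2)
  set b := √(1 - ‖v‖ ^ 2)
  have h4 : 2 * (a * b + inner ℝ u v) ≤ 2 := by
    nlinarith [sq_nonneg (a - b), sq_nonneg (‖u‖ - ‖v‖)]
  have h5 : s * t * (2 * (a * b + inner ℝ u v)) ≤ s * t * 2 := by gcongr
  have h6 : (s + t) ^ 2 = 1 := by rw [hst, one_pow]
  linear_combination h5 + h6 + s ^ 2 * h1 + t ^ 2 * h2

/-- Resolvents leave the horoballs at a Wolff point invariant. -/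
theorem resolvent_horoball {ξ x z w : E} {s t : ℝ} (hs : 0 < s) (ht : 0 ≤ t) (hst : s + t = 1)
    (hξ : ‖ξ‖ ≤ 1) (hx : ‖x‖ < 1) (hz : ‖z‖ < 1) (hw : ‖w‖ < 1) (heq : z = s • x + t • w)
    (h : (1 - inner ℝ w ξ) ^ 2 * (1 - ‖z‖ ^ 2) ≤ (1 - inner ℝ z ξ) ^ 2 * (1 - ‖w‖ ^ 2)) :
    (1 - inner ℝ z ξ) ^ 2 * (1 - ‖x‖ ^ 2) ≤ (1 - inner ℝ x ξ) ^ 2 * (1 - ‖z‖ ^ 2) := by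
  have hconc := combo_sqrt_one_sub_norm_sq_le hs.le ht hst hx.le hw.le
  rw [← heq] at hconc
  have hcomb : 1 - inner ℝ z ξ = s * (1 - inner ℝ x ξ) + t * (1 - inner ℝ w ξ) := by
    rw [heq, inner_add_left, inner_smul_left, inner_smul_left]
    simp only [conj_trivial]
    linear_combination -hst
  have pX := one_sub_inner_pos hx hξ
  have pZ := one_sub_inner_pos hz hξ
  have pW := one_sub_inner_pos hw hξ
  have qx := one_sub_norm_sq_pos hx
  have qz := one_sub_norm_sq_pos hz
  have qw := one_sub_norm_sq_pos hw
  rw [← Real.sq_sqrt qx.le, ← Real.sq_sqrt qz.le, ← mul_pow, ← mul_pow]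
  rw [← Real.sq_sqrt qz.le, ← Real.sq_sqrt qw.le, ← mul_pow, ← mul_pow] at h
  have sx := Real.sqrt_pos.2 qx
  have sz := Real.sqrt_pos.2 qz
  have sw := Real.sqrt_pos.2 qw
  generalize √(1 - ‖x‖ ^ 2) = a at *
  generalize √(1 - ‖z‖ ^ 2) = b at *
  generalize √(1 - ‖w‖ ^ 2) = c at *
  generalize 1 - inner ℝ x ξ = X at *
  generalize 1 - inner ℝ z ξ = Z at *
  generalize 1 - inner ℝ w ξ = W at *
  have h' : W * b ≤ Z * c := le_of_sq_le_sq h (by positivity)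
  gcongr ?_ ^ 2
  by_contra! hlt
  have e1 : s * (X * b) < s * (Z * a) := by gcongr
  have e2 : t * (W * b) ≤ t * (Z * c) := by gcongr
  have e3 : Z * (s * a + t * c) ≤ Z * b := by gcongr
  nlinarith

/-- Uniform convergence of resolvents in the unit ball model. -/
theorem resolvent_tendsto_wolff_point [ProperSpace E] {f : E → E}
    (hf : ∀ u, ‖u‖ < 1 → ‖f u‖ < 1)
    (hne : ∀ u v, ‖u‖ < 1 → ‖v‖ < 1 → ballCrossRatio (f u) (f v) ≤ ballCrossRatio u v)
    (hfix : ∀ u, ‖u‖ < 1 → f u ≠ u)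
    (hres : ∀ l : ℝ, 0 < l → ∃ z : E, ‖z‖ < 1 ∧ z = (l / (1 + l)) • f z) :
    ∃ ξ : E, ‖ξ‖ = 1 ∧ ∀ ε > 0, ∀ η > 0, ∃ Λ : ℝ, 0 < Λ ∧ ∀ l, Λ ≤ l → ∀ x z : E,
      ‖x‖ < 1 → ‖z‖ < 1 → z = (1 / (1 + l)) • x + (l / (1 + l)) • f z →
      ε ≤ 1 - ‖x‖ ^ 2 → ‖z - ξ‖ < η := by
  obtain ⟨ξ, hξ, hinv⟩ := exists_wolff_point hf hne hfix hres
  refine ⟨ξ, hξ, fun ε hε η hη => ?_⟩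
  obtain ⟨Λ, hΛ0, hΛ⟩ := resolvent_escapes hf hne hfix
    (ε := ε * η ^ 4 / 16) (by positivity)
  refine ⟨Λ, hΛ0, fun l hl x z hx hz heq hxε => ?_⟩
  have hl0 : 0 < l := hΛ0.trans_le hl
  have hqz := hΛ l hl x z hx hz heq
  have hh := resolvent_horoball (s := 1 / (1 + l)) (t := l / (1 + l)) (by positivity)
    (by positivity) (by field_simp) hξ.le hx hz (hf z hz) heq (hinv z hz)
  have pZ := one_sub_inner_pos hz hξ.le
  have pX := one_sub_inner_pos hx hξ.le
  have hX2 : 1 - inner ℝ x ξ ≤ 2 := by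
    have := (abs_le.1 (abs_real_inner_le_norm x ξ)).1
    rw [hξ] at this
    linarith
  have qz := one_sub_norm_sq_pos hz
  have h1 : (1 - inner ℝ z ξ) ^ 2 * ε < (η ^ 2 / 2) ^ 2 * ε := by
    calc _ ≤ (1 - inner ℝ z ξ) ^ 2 * (1 - ‖x‖ ^ 2) := by gcongr
      _ ≤ _ := hh
      _ ≤ 2 ^ 2 * (1 - ‖z‖ ^ 2) := by gcongr
      _ < 2 ^ 2 * (ε * η ^ 4 / 16) := by gcongr
      _ = _ := by ring
  have h2 : 1 - inner ℝ z ξ < η ^ 2 / 2 :=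
    lt_of_pow_lt_pow_left₀ 2 (by positivity) (lt_of_mul_lt_mul_right h1 hε.le)
  refine lt_of_pow_lt_pow_left₀ 2 hη.le ?_
  rw [norm_sub_sq_real, hξ]
  linarith

/-- A set of bounded cross-ratio from a point stays away from the unit sphere. -/
theorem le_one_sub_norm_sq_of_ballCrossRatio_le {u v : E} {M : ℝ} (hu : ‖u‖ < 1) (hv : ‖v‖ < 1)
    (hM : 0 < M) (h : ballCrossRatio u v ≤ M) :
    (1 - ‖u‖) ^ 2 / (M * (1 - ‖u‖ ^ 2)) ≤ 1 - ‖v‖ ^ 2 := by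
  have qu := one_sub_norm_sq_pos hu
  have qv := one_sub_norm_sq_pos hv
  rw [ballCrossRatio, div_le_iff₀ (by positivity)] at h
  rw [div_le_iff₀ (by positivity)]
  have h1 : 1 - ‖u‖ ≤ 1 - inner ℝ u v := by
    nlinarith [real_inner_le_norm u v, norm_nonneg u]
  have h2 : (1 - ‖u‖) ^ 2 ≤ (1 - inner ℝ u v) ^ 2 := by
    have : 0 ≤ 1 - ‖u‖ := by linarith
    gcongr
  linarith

end Ball

/-- The Hilbert metric of an affine image of the unit ball in terms of the ball model. -/
theorem IsHilbertMetric.cosh_eq {V E : Type*} [NormedAddCommGroup V] [NormedSpace ℝ V]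
    [NormedAddCommGroup E] [InnerProductSpace ℝ E] {d : V → V → ℝ} (φ : E ≃ₜ V)
    (hφ : ∀ u v : E, ∀ s t : ℝ, s + t = 1 → φ (s • u + t • v) = s • φ u + t • φ v)
    (hd : IsHilbertMetric (φ '' Metric.ball 0 1) d) {u v : E} (hu : ‖u‖ < 1) (hv : ‖v‖ < 1) :
    0 ≤ d (φ u) (φ v) ∧ Real.cosh (d (φ u) (φ v)) = 2 * ballCrossRatio u v - 1 := by
  have hmem : ∀ {w : E}, ‖w‖ < 1 → φ w ∈ φ '' Metric.ball 0 1 := fun {w} hw =>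
    Set.mem_image_of_mem _ (by simpa using hw)
  by_cases huv : u = v
  · subst huv
    rw [hd.1 _ (hmem hu), ballCrossRatio_self hu]
    norm_num
  obtain ⟨a, ha, b, hb, hxa, hyb, hdist⟩ :=
    hd.2 _ (hmem hu) _ (hmem hv) (φ.injective.ne huv)
  rw [← φ.image_frontier, frontier_ball _ one_ne_zero] at ha hb
  obtain ⟨α, hα, rfl⟩ := ha
  obtain ⟨β, hβ, rfl⟩ := hb
  have hα : ‖α‖ = 1 := by simpa using hα
  have hβ : ‖β‖ = 1 := by simpa using hβ
  obtain ⟨s', s, hs', hs, hss, hsx⟩ := hxa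
  obtain ⟨r, r', hr, hr', hrr, hry⟩ := hyb
  obtain rfl : s' = 1 - s := by linarith
  obtain rfl : r' = 1 - r := by linarith
  have hsu : u = (1 - s) • α + s • v := φ.injective (by rw [hφ _ _ _ _ hss, hsx])
  have hrv : v = (1 - r) • β + r • u := φ.injective (by rw [hφ _ _ _ _ (by ring), ← hry, add_comm])
  have hs0 : 0 < s := by
    refine hs.lt_of_ne ?_
    rintro rfl
    rw [show u = α by simpa using hsu] at hu
    exact hu.ne hα
  have hr0 : 0 < r := by
    refine hr.lt_of_ne ?_
    rintro rfl
    rw [show v = β by simpa using hrv] at hv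
    exact hv.ne hβ
  have hs1 : s < 1 := by
    refine lt_of_le_of_ne (by linarith) ?_
    rintro rfl
    exact huv (by simpa using hsu)
  have hr1 : r < 1 := by
    refine lt_of_le_of_ne (by linarith) ?_
    rintro rfl
    exact huv (by simpa using hrv.symm)
  have hxa' : φ u - φ α = s • (φ v - φ α) := by rw [← hsx]; module
  have hyb' : φ v - φ β = r • (φ u - φ β) := by rw [← hry]; module
  have hn1 : 0 < ‖φ v - φ α‖ := by
    rw [norm_pos_iff, sub_ne_zero]
    intro h
    rw [φ.injective h] at hv
    exact hv.ne hα
  have hn2 : 0 < ‖φ u - φ β‖ := by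
    rw [norm_pos_iff, sub_ne_zero]
    intro h
    rw [φ.injective h] at hu
    exact hu.ne hβ
  have hratio : (‖φ v - φ α‖ * ‖φ u - φ β‖) / (‖φ u - φ α‖ * ‖φ v - φ β‖) = (s * r)⁻¹ := by
    rw [hxa', hyb', norm_smul, norm_smul, Real.norm_of_nonneg hs, Real.norm_of_nonneg hr]
    field_simp
  rw [hratio] at hdist
  have hsr : 0 < s * r := by positivity
  have hsr1 : s * r ≤ 1 := by nlinarith
  rw [hdist]
  refine ⟨Real.log_nonneg (one_le_inv_iff₀.2 ⟨hsr, hsr1⟩), ?_⟩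
  rw [Real.cosh_log (by positivity),
    ballCrossRatio_eq_of_chord hu hv hα hβ hs0 hs1 hr0 hr1 hsu hrv]
  field_simp
  ring

theorem wolff_denjoy_for_resolvents_on_ellipsoid
    {V : Type*} [NormedAddCommGroup V] [NormedSpace ℝ V] [FiniteDimensional ℝ V]
    (D : Set V) (hDell : IsEllipsoid D)
    (hDo : IsOpen D) (hDc : Convex ℝ D) (hDb : Bornology.IsBounded D)
    (hDn : D.Nonempty)
    (dH : V → V → ℝ) (hdH : IsHilbertMetric D dH)
    (F : V → V) (hFmaps : ∀ y ∈ D, F y ∈ D)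
    (hFne : ∀ x ∈ D, ∀ y ∈ D, dH (F x) (F y) ≤ dH x y)
    (hFfix : ∀ x ∈ D, F x ≠ x)
    (R : ℝ → V → V)
    (hR : ∀ lam : ℝ, 0 < lam → ∀ x ∈ D, R lam x ∈ D ∧
      R lam x = (1 / (1 + lam)) • x + (lam / (1 + lam)) • F (R lam x)) :
    ∃ ξ ∈ closure D \ D,
      ∀ K : Set V, K ⊆ D → (∃ C : ℝ, ∀ y ∈ K, ∀ z ∈ K, dH y z ≤ C) →
        ∀ U : Set V, IsOpen U → ξ ∈ U →
          ∃ Λ : ℝ, 0 < Λ ∧ ∀ lam : ℝ, Λ ≤ lam → ∀ y ∈ K, R lam y ∈ U := by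
  obtain ⟨L, c, rfl⟩ := hDell
  let φ : EuclideanSpace ℝ (Fin (Module.finrank ℝ V)) ≃ₜ V :=
    L.toContinuousLinearEquiv.toHomeomorph.trans (Homeomorph.addLeft c)
  have hφ : ∀ u, φ u = c + L u := fun _ => rfl
  have himg : (fun u => c + L u) '' Metric.ball 0 1 = φ '' Metric.ball 0 1 := rfl
  rw [himg] at *
  have haff : ∀ u v : EuclideanSpace ℝ (Fin (Module.finrank ℝ V)), ∀ s t : ℝ, s + t = 1 →
      φ (s • u + t • v) = s • φ u + t • φ v := by
    intro u v s t hst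
    obtain rfl : t = 1 - s := by linarith
    simp only [hφ, map_add, map_smul]
    module
  have hmem : ∀ u, φ u ∈ φ '' Metric.ball 0 1 ↔ ‖u‖ < 1 := fun u => by
    rw [φ.injective.mem_set_image]
    simp
  have hmem' : ∀ x, x ∈ φ '' Metric.ball 0 1 ↔ ‖φ.symm x‖ < 1 := fun x => by
    rw [← hmem, φ.apply_symm_apply]
  have hdc : ∀ u v, ‖u‖ < 1 → ‖v‖ < 1 → 0 ≤ dH (φ u) (φ v) ∧
      Real.cosh (dH (φ u) (φ v)) = 2 * ballCrossRatio u v - 1 :=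
    fun u v hu hv => hdH.cosh_eq φ haff hu hv
  let f := fun u => φ.symm (F (φ u))
  have hf : ∀ u, ‖u‖ < 1 → ‖f u‖ < 1 := fun u hu =>
    (hmem' _).1 (hFmaps _ ((hmem u).2 hu))
  have hφf : ∀ u, φ (f u) = F (φ u) := fun u => φ.apply_symm_apply _
  have hne : ∀ u v, ‖u‖ < 1 → ‖v‖ < 1 → ballCrossRatio (f u) (f v) ≤ ballCrossRatio u v := by
    intro u v hu hv
    have h1 := hdc u v hu hv
    have h2 := hdc (f u) (f v) (hf u hu) (hf v hv)
    have h3 := hFne _ ((hmem u).2 hu) _ ((hmem v).2 hv)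
    rw [← hφf, ← hφf, ← abs_of_nonneg h1.1, ← abs_of_nonneg h2.1, ← Real.cosh_le_cosh,
      h1.2, h2.2] at h3
    linarith
  have hfix : ∀ u, ‖u‖ < 1 → f u ≠ u := fun u hu h =>
    hFfix _ ((hmem u).2 hu) (by rw [← hφf, h])
  have hRf : ∀ l : ℝ, 0 < l → ∀ u, ‖u‖ < 1 → ‖φ.symm (R l (φ u))‖ < 1 ∧
      φ.symm (R l (φ u)) = (1 / (1 + l)) • u + (l / (1 + l)) • f (φ.symm (R l (φ u))) := by
    intro l hl u hu
    obtain ⟨h1, h2⟩ := hR l hl _ ((hmem u).2 hu)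
    refine ⟨(hmem' _).1 h1, φ.injective ?_⟩
    rw [haff _ _ _ _ (by field_simp), hφf, φ.apply_symm_apply]
    exact h2
  obtain ⟨ξ, hξ, hconv⟩ := resolvent_tendsto_wolff_point hf hne hfix fun l hl =>
    ⟨_, (hRf l hl 0 (by simp)).1, by simpa using (hRf l hl 0 (by simp)).2⟩
  refine ⟨φ ξ, ⟨?_, ?_⟩, ?_⟩
  · rw [← φ.image_closure, closure_ball _ one_ne_zero]
    exact Set.mem_image_of_mem _ (by simp [hξ])
  · rw [hmem, hξ]
    exact lt_irrefl 1
  · rintro K hK ⟨C, hC⟩ U hU hξU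
    obtain rfl | ⟨y₀, hy₀⟩ := K.eq_empty_or_nonempty
    · exact ⟨1, one_pos, by simp⟩
    obtain ⟨η, hη, hball⟩ := Metric.isOpen_iff.1 (hU.preimage φ.continuous) ξ hξU
    have hu₀ := (hmem' _).1 (hK hy₀)
    have hM : 0 < (Real.cosh C + 1) / 2 := by linarith [Real.one_le_cosh C]
    have hpos : 0 < (1 - ‖φ.symm y₀‖) ^ 2 /
        ((Real.cosh C + 1) / 2 * (1 - ‖φ.symm y₀‖ ^ 2)) := by
      have := one_sub_norm_sq_pos hu₀
      have : 0 < 1 - ‖φ.symm y₀‖ := by linarith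
      positivity
    obtain ⟨Λ, hΛ0, hΛ⟩ := hconv _ hpos η hη
    refine ⟨Λ, hΛ0, fun l hl y hy => ?_⟩
    have hu := (hmem' _).1 (hK hy)
    have hbd : ballCrossRatio (φ.symm y₀) (φ.symm y) ≤ (Real.cosh C + 1) / 2 := by
      obtain ⟨h1, h2⟩ := hdc _ _ hu₀ hu
      rw [φ.apply_symm_apply, φ.apply_symm_apply] at h1 h2
      have h3 := hC _ hy₀ _ hy
      have h4 : Real.cosh (dH y₀ y) ≤ Real.cosh C := by
        rwa [Real.cosh_le_cosh, abs_of_nonneg h1, abs_of_nonneg (h1.trans h3)]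
      linarith
    obtain ⟨h1, h2⟩ := hRf l (hΛ0.trans_le hl) _ hu
    have h3 := hΛ l hl _ _ hu h1 h2 (le_one_sub_norm_sq_of_ballCrossRatio_le hu₀ hu hM hbd)
    have h4 := hball (mem_ball_iff_norm.2 h3)
    simpa using h4
end
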